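/- Theorem 8: Let k be a field and q ∈ k with q ≠ 0. Let M_q(n,k) be the quantum matrix bialgebra: the quotient of the free associative k-algebra on generators t^α_β (1 ≤ α, β ≤ n) by the relations t^α_γ t^α_δ = q·t^α_δ t^α_γ for γ < δ (same row), t^α_γ t^β_γ = q·t^β_γ t^α_γ for α < β (same column), t^α_γ t^β_δ = t^β_δ t^α_γ for α < β and γ > δ, and t^α_γ t^β_δ − t^β_δ t^α_γ = (q − q⁻¹)·t^β_γ t^α_δ for α < β and γ < δ. For increasing multi-indices K = (k_1 < … < k_m) and L = (l_1 < … < l_m) in {1,…,n}, the quantum minor is D^K_L = Σ_{σ ∈ Sym(m)} (−q)^{ℓ(σ)} · t^{k_1}_{l_{σ(1)}} t^{k_2}_{l_{σ(2)}} ⋯ t^{k_m}_{l_{σ(m)}}, where ℓ(σ) is the number of inversions of σ. Then for every set Q of quantum minors, the multiplicative submonoid S of M_q(n,k) generated by Q is a two-sided Ore set, i.e. it satisfies both the left Ore condition (for every s ∈ S, r ∈ M_q(n,k) there exist s' ∈ S, r' with r's = s'r) and the right Ore condition (for every s ∈ S, r there exist s'' ∈ S, r'' with sr'' = rs''), and the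 Ore localization map M_q(n,k) → S⁻¹M_q(n,k) is injective. -/

import Mathlib

universe u


/-- The generator `t^i_j` of the free algebra on `n²` generators. -/
noncomputable def freeGen {k : Type u} [Field k] {n : ℕ} (i j : Fin n) :
    FreeAlgebra k (Fin n × Fin n) :=
  FreeAlgebra.ι k (i, j)

/-- The defining relations of the quantum matrix bialgebra `M_q(n,k)`. -/
inductive qMatRel (k : Type u) [Field k] (q : k) (n : ℕ) :
    FreeAlgebra k (Fin n × Fin n) → FreeAlgebra k (Fin n × Fin n) → Prop
  | row (α γ δ : Fin n) (h : γ < δ) :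
      qMatRel k q n (freeGen α γ * freeGen α δ) (q • (freeGen α δ * freeGen α γ))
  | col (α β γ : Fin n) (h : α < β) :
      qMatRel k q n (freeGen α γ * freeGen β γ) (q • (freeGen β γ * freeGen α γ))
  | cross (α β γ δ : Fin n) (h₁ : α < β) (h₂ : δ < γ) :
      qMatRel k q n (freeGen α γ * freeGen β δ) (freeGen β δ * freeGen α γ)
  | qcross (α β γ δ : Fin n) (h₁ : α < β) (h₂ : γ < δ) :
      qMatRel k q n (freeGen α γ * freeGen β δ - freeGen β δ * freeGen α γ)
        ((q - q⁻¹) • (freeGen β γ * freeGen α δ))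

/-- The quantum matrix bialgebra `M_q(n,k)`. -/
noncomputable abbrev QuantumMatrixAlgebra (k : Type u) [Field k] (q : k) (n : ℕ) :=
  RingQuot (qMatRel k q n)

/-- The generator `t^i_j` of `M_q(n,k)`. -/
noncomputable def qGen {k : Type u} [Field k] (q : k) {n : ℕ} (i j : Fin n) :
    QuantumMatrixAlgebra k q n :=
  RingQuot.mkAlgHom k (qMatRel k q n) (freeGen i j)

/-- The number of inversions of a permutation. -/
def inversions {m : ℕ} (σ : Equiv.Perm (Fin m)) : ℕ :=
  (Finset.univ.filter fun p : Fin m × Fin m => p.1 < p.2 ∧ σ p.2 < σ p.1).card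

/-- The quantum minor `D^K_L = Σ_σ (−q)^{ℓ(σ)} t^{k₁}_{l_{σ(1)}} ⋯ t^{k_m}_{l_{σ(m)}}`
associated to multi-indices `K`, `L`. -/
noncomputable def qMinor {k : Type u} [Field k] (q : k) {n : ℕ} {m : ℕ}
    (K L : Fin m → Fin n) : QuantumMatrixAlgebra k q n :=
  ∑ σ : Equiv.Perm (Fin m),
    ((-q) ^ inversions σ) • ((List.finRange m).map fun a => qGen q (K a) (L (σ a))).prod

/-- The set of all quantum minors of `M_q(n,k)` (for all sizes `m` and all increasing
row and column multi-indices). -/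
def quantumMinors (k : Type u) [Field k] (q : k) (n : ℕ) :
    Set (QuantumMatrixAlgebra k q n) :=
  {x | ∃ (m : ℕ) (K L : Fin m → Fin n), StrictMono K ∧ StrictMono L ∧ x = qMinor q K L}

/-- `i : R →+* Q` realizes `Q` as the left Ore localization `S⁻¹R`. -/
structure IsLeftOreRingLocalization {R : Type u} [Ring R] (S : Set R)
    {Q : Type u} [Ring Q] (i : R →+* Q) : Prop where
  isUnit : ∀ s ∈ S, IsUnit (i s)
  surj : ∀ x : Q, ∃ s ∈ S, ∃ r : R, i s * x = i r
  ker : ∀ r : R, i r = 0 ↔ ∃ s ∈ S, s * r = 0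

structure QM {k : Type*} [Field k] (q : k) {R : Type*} [Ring R] [Algebra k R] {n : ℕ}
    (t : Fin n → Fin n → R) : Prop where
  row : ∀ α γ δ : Fin n, γ < δ → t α γ * t α δ = q • (t α δ * t α γ)
  col : ∀ α β γ : Fin n, α < β → t α γ * t β γ = q • (t β γ * t α γ)
  cross : ∀ α β γ δ : Fin n, α < β → δ < γ → t α γ * t β δ = t β δ * t α γ
  qcross : ∀ α β γ δ : Fin n, α < β → γ < δ →
    t α γ * t β δ - t β δ * t α γ = (q - q⁻¹) • (t β γ * t α δ)

namespace QMin

section basic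
variable {n : ℕ}

def lo (S : Finset (Fin n)) (j : Fin n) : ℕ := (S.filter (· < j)).card
def hi (S : Finset (Fin n)) (j : Fin n) : ℕ := (S.filter (j < ·)).card

lemma lo_erase_of_lt {S : Finset (Fin n)} {j l : Fin n} (hj : j ∈ S) (h : j < l) :
    lo S l = lo (S.erase j) l + 1 := by
  unfold lo
  have e : (S.erase j).filter (· < l) = (S.filter (· < l)).erase j := by
    ext x; simp only [Finset.mem_filter, Finset.mem_erase]; tauto
  rw [e, Finset.card_erase_add_one]
  simp [hj, h]

lemma lo_erase_of_le {S : Finset (Fin n)} {j l : Fin n} (h : l ≤ j) :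
    lo (S.erase j) l = lo S l := by
  unfold lo
  congr 1
  ext x; simp only [Finset.mem_filter, Finset.mem_erase]
  constructor
  · tauto
  · rintro ⟨a, b⟩; exact ⟨⟨by intro h'; subst h'; exact absurd (lt_of_lt_of_le b h) (lt_irrefl _), a⟩, b⟩

lemma lo_insert_of_lt {S : Finset (Fin n)} {j l : Fin n} (hj : j ∉ S) (h : j < l) :
    lo (insert j S) l = lo S l + 1 := by
  have := lo_erase_of_lt (S := insert j S) (j := j) (l := l) (by simp) h
  rwa [Finset.erase_insert hj] at this

lemma lo_insert_of_le {S : Finset (Fin n)} {j l : Fin n} (h : l ≤ j) :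
    lo (insert j S) l = lo S l := by
  unfold lo
  rw [Finset.filter_insert, if_neg (not_lt.2 h)]

lemma hi_insert_of_lt {S : Finset (Fin n)} {j l : Fin n} (h : j < l) :
    hi (insert j S) l = hi S l := by
  unfold hi
  rw [Finset.filter_insert, if_neg (not_lt.2 h.le)]

lemma lo_add_hi {S : Finset (Fin n)} {j : Fin n} (hj : j ∈ S) : lo S j + hi S j + 1 = S.card := by
  unfold lo hi
  rw [← Finset.card_union_of_disjoint]
  · have : S.filter (· < j) ∪ S.filter (j < ·) = S.erase j := by
      ext x; simp only [Finset.mem_union, Finset.mem_filter, Finset.mem_erase, ne_eq]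
      have := lt_trichotomy x j
      grind
    rw [this, Finset.card_erase_add_one hj]
  · rw [Finset.disjoint_filter]; intro x _ h1 h2; exact absurd (h1.trans h2) (lt_irrefl _)

lemma sum_pairs {M : Type*} [AddCommMonoid M] (S : Finset (Fin n)) (f : Fin n → Fin n → M) :
    ∑ j ∈ S, ∑ l ∈ S.erase j, f j l = ∑ j ∈ S, ∑ l ∈ S.filter (j < ·), (f j l + f l j) := by
  have h1 : ∀ j ∈ S, ∑ l ∈ S.erase j, f j l =
      ∑ l ∈ S.filter (j < ·), f j l + ∑ l ∈ S.filter (· < j), f j l := by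
    intro j hj
    rw [← Finset.sum_union]
    · congr 1
      ext x; simp only [Finset.mem_union, Finset.mem_filter, Finset.mem_erase, ne_eq]
      have := lt_trichotomy x j
      grind
    · rw [Finset.disjoint_filter]; intro x _ h1 h2; exact absurd (h1.trans h2) (lt_irrefl _)
  rw [Finset.sum_congr rfl h1, Finset.sum_add_distrib]
  simp only [Finset.sum_add_distrib]
  congr 1
  simp only [Finset.sum_filter]
  rw [Finset.sum_comm]

lemma sum_pairs_congr {M : Type*} [AddCommMonoid M] (S : Finset (Fin n)) (f g : Fin n → Fin n → M)
    (h : ∀ j ∈ S, ∀ l ∈ S, j < l → f j l + f l j = g j l + g l j) :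
    ∑ j ∈ S, ∑ l ∈ S.erase j, f j l = ∑ j ∈ S, ∑ l ∈ S.erase j, g j l := by
  rw [sum_pairs, sum_pairs]
  refine Finset.sum_congr rfl fun j hj => Finset.sum_congr rfl fun l hl => ?_
  rw [Finset.mem_filter] at hl
  exact h j hj l hl.1 hl.2

end basic

section alg
variable {k : Type*} [Field k] (q : k) {R : Type*} [Ring R] [Algebra k R] {n : ℕ}
    (t : Fin n → Fin n → R)

def Lrow (i : Fin n) (F : Finset (Fin n) → R) (S : Finset (Fin n)) : R :=
  ∑ j ∈ S, ((-q) ^ lo S j) • (t i j * F (S.erase j))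

def D0 (S : Finset (Fin n)) : R := if S = ∅ then 1 else 0

def Dm (K : Finset (Fin n)) : Finset (Fin n) → R :=
  (K.sort (· ≤ ·)).foldr (fun i F => Lrow q t i F) D0

lemma Dm_empty : Dm q t ∅ = D0 := by simp [Dm]

lemma Dm_insert {K : Finset (Fin n)} {i : Fin n} (h : ∀ x ∈ K, i < x) :
    Dm q t (insert i K) = Lrow q t i (Dm q t K) := by
  unfold Dm
  rw [Finset.sort_insert]
  · rfl
  · exact fun b hb => (h b hb).le
  · exact fun hb => lt_irrefl _ (h _ hb)

lemma Lrow_smul (i : Fin n) (c : k) (F : Finset (Fin n) → R) :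
    Lrow q t i (c • F) = c • Lrow q t i F := by
  funext S
  simp only [Lrow, Pi.smul_apply, Finset.smul_sum, mul_smul_comm]
  refine Finset.sum_congr rfl fun j _ => ?_
  rw [smul_comm]

lemma Lrow_zero (i : Fin n) : Lrow q t i 0 = 0 := by
  funext S; simp [Lrow]

lemma Lrow_Lrow (i i' : Fin n) (F : Finset (Fin n) → R) (S : Finset (Fin n)) :
    Lrow q t i (Lrow q t i' F) S = ∑ j ∈ S, ∑ l ∈ S.erase j,
      ((-q) ^ (lo S j + lo (S.erase j) l)) • ((t i j * t i' l) * F ((S.erase j).erase l)) := by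
  simp only [Lrow, Finset.mul_sum, Finset.smul_sum, mul_smul_comm, smul_smul, pow_add, mul_assoc]

variable {q t}

lemma Lrow_self (h : QM q t) (i : Fin n) (F : Finset (Fin n) → R) :
    Lrow q t i (Lrow q t i F) = 0 := by
  funext S
  rw [Lrow_Lrow, Pi.zero_apply]
  have h0 : (0 : R) = ∑ j ∈ S, ∑ l ∈ S.erase j, (0 : R) := by simp
  rw [h0]
  refine sum_pairs_congr S _ (fun _ _ => 0) fun j hj l hl hjl => ?_
  rw [lo_erase_of_le hjl.le, lo_erase_of_lt hj hjl, h.row i j l hjl, Finset.erase_right_comm]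
  simp only [pow_add, pow_one, smul_mul_assoc]
  module

lemma Lrow_swap (hq : q ≠ 0) (h : QM q t) {α β : Fin n} (hab : α < β) (F : Finset (Fin n) → R) :
    Lrow q t β (Lrow q t α F) = (-q) • Lrow q t α (Lrow q t β F) := by
  funext S
  rw [Lrow_Lrow, Pi.smul_apply, Lrow_Lrow]
  simp only [Finset.smul_sum]
  refine sum_pairs_congr S _ _ fun j hj l hl hjl => ?_
  rw [lo_erase_of_le hjl.le, lo_erase_of_lt hj hjl, Finset.erase_right_comm]
  have h1 := h.cross α β l j hab hjl
  have h2 := h.qcross α β j l hab hjl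
  have h3 : t α j * t β l = t β l * t α j + (q - q⁻¹) • (t β j * t α l) := by
    rw [← h2]; abel
  rw [h1, h3]
  simp only [pow_add, pow_one, smul_mul_assoc, add_mul]
  match_scalars <;> field_simp <;> ring

theorem laplace_row (hq : q ≠ 0) (h : QM q t) (i : Fin n) (K : Finset (Fin n)) :
    Lrow q t i (Dm q t K) = if i ∈ K then 0 else ((-q) ^ lo K i) • Dm q t (insert i K) := by
  induction K using Finset.induction_on_min with
  | empty =>
    rw [if_neg (by simp), Dm_insert q t (by simp)]; simp [lo]
  | insert a K ha ih =>
    rcases lt_trichotomy i a with hlt | rfl | hgt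
    · have hi : ∀ x ∈ insert a K, i < x := by
        intro x hx; rcases Finset.mem_insert.1 hx with rfl | hx
        · exact hlt
        · exact hlt.trans (ha x hx)
      rw [if_neg (fun hm => lt_irrefl _ (hi _ hm)), Dm_insert q t hi]
      have : lo (insert a K) i = 0 := by
        unfold lo; rw [Finset.card_eq_zero, Finset.filter_eq_empty_iff]
        exact fun x hx => not_lt.2 (hi x hx).le
      simp [this]
    · rw [Dm_insert q t ha, Lrow_self h]; simp
    · rw [Dm_insert q t ha, Lrow_swap hq h hgt, ih]
      have hne : i ≠ a := hgt.ne'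
      have haK : a ∉ K := fun hm => lt_irrefl _ (ha _ hm)
      by_cases hiK : i ∈ K
      · simp [hiK, Lrow_zero]
      · rw [if_neg hiK, if_neg (by simp [hne, hiK]), Lrow_smul, smul_smul, Finset.insert_comm,
          Dm_insert q t (K := insert i K), lo_insert_of_lt haK hgt, pow_succ']
        intro x hx; rcases Finset.mem_insert.1 hx with rfl | hx
        · exact hgt
        · exact ha x hx

lemma Dm_card {K S : Finset (Fin n)} (hc : K.card ≠ S.card) : Dm q t K S = 0 := by
  induction K using Finset.induction_on_min generalizing S with
  | empty =>
    rw [Dm_empty, D0, if_neg]; rintro rfl; simp at hc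
  | insert a K ha ih =>
    have haK : a ∉ K := fun hm => lt_irrefl _ (ha _ hm)
    rw [Dm_insert q t ha, Lrow]
    refine Finset.sum_eq_zero fun j hj => ?_
    rw [ih, mul_zero, smul_zero]
    rw [Finset.card_insert_of_notMem haK] at hc
    have := Finset.card_erase_add_one hj
    omega

lemma commute_Dm {z : R} {K S : Finset (Fin n)} (hz : ∀ i ∈ K, ∀ j ∈ S, Commute z (t i j)) :
    Commute z (Dm q t K S) := by
  induction K using Finset.induction_on_min generalizing S with
  | empty =>
    rw [Dm_empty, D0]; split_ifs <;> simp
  | insert a K ha ih =>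
    rw [Dm_insert q t ha, Lrow]
    refine Commute.sum_right _ _ _ fun j hj => ?_
    refine Commute.smul_right (Commute.mul_right (hz a (by simp) j hj) (ih ?_)) _
    intro i hi l hl
    exact hz i (by simp [hi]) l (Finset.mem_of_mem_erase hl)

lemma last_col (h : QM q t) {K S : Finset (Fin n)} {s : Fin n} (hs : ∀ x ∈ S, x < s) :
    Dm q t K (insert s S) = ∑ i ∈ K, ((-q) ^ hi K i) • (Dm q t (K.erase i) S * t i s) := by
  have hsS : s ∉ S := fun hm => lt_irrefl _ (hs _ hm)
  induction K using Finset.induction_on_min generalizing S with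
  | empty => rw [Dm_empty, D0, if_neg (by simp)]; simp
  | insert a K ha ih =>
    have haK : a ∉ K := fun hm => lt_irrefl _ (ha _ hm)
    rw [Dm_insert q t ha, Lrow, Finset.sum_insert hsS, Finset.sum_insert haK,
      Finset.erase_insert haK, Finset.erase_insert hsS]
    congr 1
    · have hcomm : t a s * Dm q t K S = Dm q t K S * t a s := by
        refine commute_Dm fun i hi j hj => ?_
        exact h.cross a i s j (ha i hi) (hs j hj)
      rw [hcomm]
      by_cases hc : K.card = S.card
      · have h1 : lo (insert s S) s = S.card := by
          rw [lo_insert_of_le le_rfl, lo, Finset.filter_true_of_mem hs]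
        have h2 : hi (insert a K) a = K.card := by
          rw [hi, Finset.filter_insert, if_neg (lt_irrefl _), Finset.filter_true_of_mem ha]
        rw [h1, h2, hc]
      · rw [Dm_card hc]; simp
    · have e1 : ∀ j ∈ S, ((-q) ^ lo (insert s S) j) • (t a j * Dm q t K ((insert s S).erase j)) =
          ∑ i ∈ K, ((-q) ^ lo S j * (-q) ^ hi K i) •
            (t a j * (Dm q t (K.erase i) (S.erase j) * t i s)) := by
        intro j hj
        have hjs : s ≠ j := (hs j hj).ne'
        rw [Finset.erase_insert_of_ne hjs, lo_insert_of_le (hs j hj).le, ih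
          (fun x hx => hs x (Finset.mem_of_mem_erase hx)) (fun hm => hsS (Finset.mem_of_mem_erase hm))]
        simp only [Finset.mul_sum, Finset.smul_sum, mul_smul_comm, smul_smul]
      have e2 : ∀ i ∈ K, ((-q) ^ hi (insert a K) i) • (Dm q t ((insert a K).erase i) S * t i s) =
          ∑ j ∈ S, ((-q) ^ lo S j * (-q) ^ hi K i) •
            (t a j * (Dm q t (K.erase i) (S.erase j) * t i s)) := by
        intro i hi'
        rw [Finset.erase_insert_of_ne (ha i hi').ne, hi_insert_of_lt (ha i hi'),
          Dm_insert q t (fun x hx => ha x (Finset.mem_of_mem_erase hx)), Lrow]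
        simp only [Finset.sum_mul, Finset.smul_sum, smul_mul_assoc, smul_smul, mul_assoc]
        refine Finset.sum_congr rfl fun j _ => ?_
        rw [mul_comm]
      rw [Finset.sum_congr rfl e1, Finset.sum_congr rfl e2, Finset.sum_comm]

open MulOpposite

def opt (t : Fin n → Fin n → R) : Fin n → Fin n → Rᵐᵒᵖ := fun i j => op (t j.rev i.rev)

lemma QM.opq (h : QM q t) : QM q (opt t) where
  row α γ δ hh := by
    simp only [opt, ← op_mul, ← op_smul]
    rw [h.col _ _ _ (Fin.rev_lt_rev.2 hh)]
  col α β γ hh := by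
    simp only [opt, ← op_mul, ← op_smul]
    rw [h.row _ _ _ (Fin.rev_lt_rev.2 hh)]
  cross α β γ δ h1 h2 := by
    simp only [opt, ← op_mul, ← op_smul]
    rw [h.cross _ _ _ _ (Fin.rev_lt_rev.2 h2) (Fin.rev_lt_rev.2 h1)]
  qcross α β γ δ h1 h2 := by
    simp only [opt, ← op_mul, ← op_smul, ← op_sub]
    rw [h.qcross _ _ _ _ (Fin.rev_lt_rev.2 h2) (Fin.rev_lt_rev.2 h1),
      h.cross _ _ _ _ (Fin.rev_lt_rev.2 h2) (Fin.rev_lt_rev.2 h1)]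

def rv (S : Finset (Fin n)) : Finset (Fin n) := S.map Fin.revPerm.toEmbedding

@[simp] lemma mem_rv {S : Finset (Fin n)} {x : Fin n} : x ∈ rv S ↔ x.rev ∈ S := by
  simp only [rv, Finset.mem_map_equiv, Fin.revPerm_symm, Fin.revPerm_apply]

@[simp] lemma rv_rv (S : Finset (Fin n)) : rv (rv S) = S := by ext; simp

@[simp] lemma card_rv (S : Finset (Fin n)) : (rv S).card = S.card := by simp [rv]

lemma rv_insert (S : Finset (Fin n)) (i : Fin n) : rv (insert i S) = insert i.rev (rv S) := by
  ext x; simp [Fin.rev_eq_iff]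

lemma rv_erase (S : Finset (Fin n)) (i : Fin n) : rv (S.erase i) = (rv S).erase i.rev := by
  ext x; simp [Fin.rev_eq_iff]

lemma hi_rv (S : Finset (Fin n)) (i : Fin n) : hi (rv S) i.rev = lo S i := by
  unfold hi lo rv
  rw [Finset.filter_map, Finset.card_map]
  congr 1
  ext x
  simp [Fin.rev_lt_rev]

lemma lo_rv (S : Finset (Fin n)) (i : Fin n) : lo (rv S) i.rev = hi S i := by
  have := hi_rv (rv S) i.rev
  rw [rv_rv, Fin.rev_rev] at this
  exact this.symm

lemma sum_rv {M : Type*} [AddCommMonoid M] (S : Finset (Fin n)) (f : Fin n → M) :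
    ∑ x ∈ rv S, f x = ∑ x ∈ S, f x.rev := by
  simp [rv]

lemma Dm_op (h : QM q t) (K S : Finset (Fin n)) :
    Dm q (opt t) K S = op (Dm q t (rv S) (rv K)) := by
  induction K using Finset.induction_on_min generalizing S with
  | empty =>
    rw [Dm_empty, D0]
    by_cases hS : S = ∅
    · subst hS
      simp [rv, Dm_empty, D0]
    · rw [if_neg hS, Dm_card]
      · simp
      · simpa [rv] using hS
  | insert a K ha ih =>
    rw [Dm_insert q _ ha, Lrow, rv_insert, last_col h, sum_rv]
    · rw [Finset.op_sum]
      refine Finset.sum_congr rfl fun j _ => ?_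
      rw [ih, hi_rv, op_smul, op_mul, rv_erase, opt]
    · intro x hx
      have := ha _ (mem_rv.1 hx)
      exact Fin.lt_rev_iff.1 this

theorem laplace_col (hq : q ≠ 0) (h : QM q t) (l : Fin n) (K S : Finset (Fin n)) :
    ∑ i ∈ K, ((-q) ^ hi K i) • (Dm q t (K.erase i) S * t i l) =
      if l ∈ S then 0 else ((-q) ^ hi S l) • Dm q t K (insert l S) := by
  have h1 := congrFun (laplace_row hq (QM.opq h) l.rev (rv S)) (rv K)
  have h2 := congrArg unop h1
  rw [Lrow, sum_rv, Finset.unop_sum] at h2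
  have e : ∀ x ∈ K, unop ((-q) ^ lo (rv K) x.rev • (opt t l.rev x.rev * Dm q (opt t) (rv S) ((rv K).erase x.rev))) = ((-q) ^ hi K x) • (Dm q t (K.erase x) S * t x l) := by
    intro x _
    rw [Dm_op h, unop_smul, unop_mul, lo_rv, opt, ← rv_erase]
    simp
  rw [Finset.sum_congr rfl e] at h2
  rw [h2]
  by_cases hl : l ∈ S
  · rw [if_pos hl, if_pos (by simpa using hl)]; simp
  · rw [if_neg hl, if_neg (by simpa using hl), Pi.smul_apply, Dm_op h, lo_rv, ← rv_insert]
    simp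

end alg
end QMin
namespace QMin
section comm
variable {k : Type*} [Field k] {q : k} {R : Type*} [Ring R] [Algebra k R] {n : ℕ}
    {t : Fin n → Fin n → R}

/-- Entries of the quantum adjugate. -/
def Adj (q : k) (t : Fin n → Fin n → R) (K L : Finset (Fin n)) (c i : Fin n) : R :=
  ((-q) ^ lo L c * ((-q) ^ lo K i)⁻¹) • Dm q t (K.erase i) (L.erase c)

lemma T_adj (hq : q ≠ 0) (h : QM q t) {K L : Finset (Fin n)} {i j : Fin n} (hi : i ∈ K)
    (hj : j ∈ K) : ∑ c ∈ L, t i c * Adj q t K L c j = if i = j then Dm q t K L else 0 := by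
  have hp : -q ≠ 0 := neg_ne_zero.2 hq
  have h1 := congrFun (laplace_row hq h i (K.erase j)) L
  rw [Lrow] at h1
  have e : ∑ c ∈ L, t i c * Adj q t K L c j = ((-q) ^ lo K j)⁻¹ •
      ∑ c ∈ L, (-q) ^ lo L c • (t i c * Dm q t (K.erase j) (L.erase c)) := by
    rw [Finset.smul_sum]
    refine Finset.sum_congr rfl fun c _ => ?_
    rw [Adj, mul_smul_comm, smul_smul, mul_comm]
  rw [e, h1]
  by_cases hij : i = j
  · subst hij
    rw [if_neg (by simp), if_pos rfl, Finset.insert_erase hi, lo_erase_of_le le_rfl,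
      Pi.smul_apply, smul_smul, inv_mul_cancel₀ (pow_ne_zero _ hp), one_smul]
  · rw [if_pos (by simp [hij, hi]), if_neg hij]; simp

lemma adj_T (hq : q ≠ 0) (h : QM q t) {K L : Finset (Fin n)} (hc : K.card = L.card)
    {c : Fin n} (hcL : c ∈ L) (a : Fin n) :
    ∑ i ∈ K, Adj q t K L c i * t i a = if a ∈ L.erase c then 0 else
      ((-q) ^ hi (L.erase c) a * ((-q) ^ hi L c)⁻¹) • Dm q t K (insert a (L.erase c)) := by
  have hp : -q ≠ 0 := neg_ne_zero.2 hq
  have e : ∑ i ∈ K, Adj q t K L c i * t i a = ((-q) ^ hi L c)⁻¹ •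
      ∑ i ∈ K, (-q) ^ hi K i • (Dm q t (K.erase i) (L.erase c) * t i a) := by
    rw [Finset.smul_sum]
    refine Finset.sum_congr rfl fun i hiK => ?_
    rw [Adj, smul_mul_assoc, smul_smul]
    congr 1
    have h1 := lo_add_hi hcL
    have h2 := lo_add_hi hiK
    have h3 : lo L c + hi L c = lo K i + hi K i := by omega
    have h4 : (-q) ^ lo L c * (-q) ^ hi L c = (-q) ^ lo K i * (-q) ^ hi K i := by
      rw [← pow_add, ← pow_add, h3]
    have h5 := pow_ne_zero (lo K i) hp
    have h6 := pow_ne_zero (hi L c) hp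
    rw [← div_eq_mul_inv, mul_comm, ← div_eq_mul_inv, div_eq_div_iff h5 h6, h4, mul_comm]
  rw [e, laplace_col hq h]
  split_ifs with h1
  · simp
  · rw [smul_smul, mul_comm]

lemma Dm_mul_t (hq : q ≠ 0) (h : QM q t) {K L : Finset (Fin n)} (hc : K.card = L.card)
    {i : Fin n} (hi' : i ∈ K) (a : Fin n) :
    Dm q t K L * t i a = ∑ c ∈ L, t i c * (if a ∈ L.erase c then 0 else
      ((-q) ^ hi (L.erase c) a * ((-q) ^ hi L c)⁻¹) • Dm q t K (insert a (L.erase c))) := by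
  have e : ∑ c ∈ L, t i c * (∑ j ∈ K, Adj q t K L c j * t j a) = Dm q t K L * t i a := by
    simp only [Finset.mul_sum]
    rw [Finset.sum_comm]
    have : ∀ j ∈ K, ∑ c ∈ L, t i c * (Adj q t K L c j * t j a) =
        (if i = j then Dm q t K L else 0) * t j a := by
      intro j hj
      rw [← T_adj hq h hi' hj, Finset.sum_mul]
      simp only [mul_assoc]
    rw [Finset.sum_congr rfl this]
    simp [hi']
  rw [← e]
  exact Finset.sum_congr rfl fun c hcL => by rw [adj_T hq h hc hcL]

lemma Dm_central (hq : q ≠ 0) (h : QM q t) {K L : Finset (Fin n)} (hc : K.card = L.card)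
    {i a : Fin n} (hi' : i ∈ K) (ha : a ∈ L) : Commute (Dm q t K L) (t i a) := by
  have hp : -q ≠ 0 := neg_ne_zero.2 hq
  rw [Commute, SemiconjBy, Dm_mul_t hq h hc hi', Finset.sum_eq_single a]
  · rw [if_neg (by simp), Finset.insert_erase ha]
    have : hi (L.erase a) a = hi L a := by
      unfold hi; congr 1; ext x; simp only [Finset.mem_filter, Finset.mem_erase]
      constructor
      · tauto
      · rintro ⟨h1, h2⟩; exact ⟨⟨h2.ne', h1⟩, h2⟩
    rw [this, mul_inv_cancel₀ (pow_ne_zero _ hp), one_smul]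
  · intro c _ hca
    rw [if_pos (by simp [ha, hca.symm]), mul_zero]
  · exact fun hh => absurd ha hh

/-- the neighbouring minor -/
abbrev yy (q : k) (t : Fin n → Fin n → R) (K L : Finset (Fin n)) (b c : Fin n) : R :=
  Dm q t K (insert b (L.erase c))

lemma Dm_mul_t_out (hq : q ≠ 0) (h : QM q t) {K L : Finset (Fin n)} (hc : K.card = L.card)
    {b : Fin n} (hb : b ∉ L) : ∃ κ : Fin n → k, (∀ c, κ c ≠ 0) ∧ ∀ i ∈ K,
    Dm q t K L * t i b = ∑ c ∈ L, κ c • (t i c * yy q t K L b c) := by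
  have hp : -q ≠ 0 := neg_ne_zero.2 hq
  refine ⟨fun c => (-q) ^ hi (L.erase c) b * ((-q) ^ hi L c)⁻¹, fun c =>
    mul_ne_zero (pow_ne_zero _ hp) (inv_ne_zero (pow_ne_zero _ hp)), fun i hi' => ?_⟩
  rw [Dm_mul_t hq h hc hi']
  refine Finset.sum_congr rfl fun c _ => ?_
  rw [if_neg (by simp [hb]), mul_smul_comm]

lemma t_mul_Dm_out (hq : q ≠ 0) (h : QM q t) {K L : Finset (Fin n)}
    {b : Fin n} (hb : b ∉ L) : ∃ d : Fin n → k, (∀ c, d c ≠ 0) ∧ ∀ i, ∃ s : k,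
    t i b * Dm q t K L = (if i ∈ K then 0 else s • Dm q t (insert i K) (insert b L)) -
      ∑ c ∈ L, d c • (t i c * yy q t K L b c) := by
  have hp : -q ≠ 0 := neg_ne_zero.2 hq
  refine ⟨fun c => ((-q) ^ lo (insert b L) b)⁻¹ * (-q) ^ lo (insert b L) c, fun c =>
    mul_ne_zero (inv_ne_zero (pow_ne_zero _ hp)) (pow_ne_zero _ hp), fun i => 
    ⟨((-q) ^ lo (insert b L) b)⁻¹ * (-q) ^ lo K i, ?_⟩⟩
  have h1 := congrFun (laplace_row hq h i K) (insert b L)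
  rw [Lrow, Finset.sum_insert hb, Finset.erase_insert hb] at h1
  have h2 := congrArg (fun z => ((-q) ^ lo (insert b L) b)⁻¹ • z) h1
  simp only [smul_add, smul_smul, inv_mul_cancel₀ (pow_ne_zero _ hp), one_smul, Finset.smul_sum] at h2
  rw [eq_sub_iff_add_eq]
  rw [Finset.sum_congr rfl (g := fun c => (((-q) ^ lo (insert b L) b)⁻¹ * (-q) ^ lo (insert b L) c) •
    (t i c * Dm q t K ((insert b L).erase c)))]
  · rw [h2]
    split_ifs
    · simp
    · rw [Pi.smul_apply, smul_smul]
  · intro c hc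
    rw [Finset.erase_insert_of_ne]
    rintro rfl; exact hb hc

variable [NoZeroDivisors R]

lemma null_vec (hq : q ≠ 0) (h : QM q t) {K L : Finset (Fin n)} (hc : K.card = L.card)
    (hD : Dm q t K L ≠ 0) {v : Fin n → R} (hv : ∀ i ∈ K, ∑ a ∈ L, t i a * v a = 0)
    {c : Fin n} (hcL : c ∈ L) : v c = 0 := by
  have hp : -q ≠ 0 := neg_ne_zero.2 hq
  have e : ∑ i ∈ K, Adj q t K L c i * (∑ a ∈ L, t i a * v a) = 0 :=
    Finset.sum_eq_zero fun i hi' => by rw [hv i hi', mul_zero]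
  simp only [Finset.mul_sum] at e
  rw [Finset.sum_comm] at e
  simp only [← mul_assoc, ← Finset.sum_mul] at e
  rw [Finset.sum_congr rfl (fun a ha => by rw [adj_T hq h hc hcL]), Finset.sum_eq_single c] at e
  · rw [if_neg (by simp), Finset.insert_erase hcL] at e
    rw [smul_mul_assoc] at e
    rcases smul_eq_zero.1 e with e | e
    · exact absurd e (mul_ne_zero (pow_ne_zero _ hp) (inv_ne_zero (pow_ne_zero _ hp)))
    · exact (mul_eq_zero.1 e).resolve_left hD
  · intro a ha hac
    rw [if_pos (by simp [ha, hac]), zero_mul]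
  · exact fun hh => absurd hcL hh

lemma qcomm (hq : q ≠ 0) (h : QM q t) {K L : Finset (Fin n)} (hc : K.card = L.card)
    (hD : Dm q t K L ≠ 0) {b : Fin n} (hb : b ∉ L) {c : Fin n} (hcL : c ∈ L) :
    ∃ e : k, e ≠ 0 ∧ Dm q t K L * yy q t K L b c = e • (yy q t K L b c * Dm q t K L) := by
  obtain ⟨κ, hκ, h1⟩ := Dm_mul_t_out hq h hc hb
  obtain ⟨d, hd, h2⟩ := t_mul_Dm_out (K := K) hq h hb
  set y := Dm q t K L with hy
  have key : ∀ i ∈ K, ∑ a ∈ L, t i a * (κ a • (yy q t K L b a * y) + d a • (y * yy q t K L b a)) = 0 := by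
    intro i hi'
    obtain ⟨s, h3⟩ := h2 i
    rw [if_pos hi', zero_sub] at h3
    have e1 : y * t i b * y = ∑ a ∈ L, t i a * (κ a • (yy q t K L b a * y)) := by
      rw [h1 i hi', Finset.sum_mul]
      refine Finset.sum_congr rfl fun a _ => ?_
      rw [smul_mul_assoc, mul_smul_comm, mul_assoc]
    have e2 : y * t i b * y = - ∑ a ∈ L, t i a * (d a • (y * yy q t K L b a)) := by
      rw [mul_assoc, h3, mul_neg, Finset.mul_sum]
      congr 1
      refine Finset.sum_congr rfl fun a ha => ?_
      rw [mul_smul_comm, mul_smul_comm, ← mul_assoc, ← mul_assoc,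
        (Dm_central hq h hc hi' ha).eq]
    simp only [mul_add, Finset.sum_add_distrib]
    rw [← e1, e2, neg_add_cancel]
  have := null_vec hq h hc hD key hcL
  refine ⟨-(d c)⁻¹ * κ c, mul_ne_zero (neg_ne_zero.2 (inv_ne_zero (hd c))) (hκ c), ?_⟩
  have h5 : y * yy q t K L b c = (d c)⁻¹ • (d c • (y * yy q t K L b c)) := by
    rw [smul_smul, inv_mul_cancel₀ (hd c), one_smul]
  rw [h5, (eq_neg_of_add_eq_zero_right this), smul_neg, smul_smul, neg_mul, neg_smul]

/-- Left Ore predicate for powers of `y`. -/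
def LO {R : Type*} [Ring R] (y r : R) : Prop := ∀ m : ℕ, ∃ N : ℕ, ∃ r' : R, y ^ N * r = r' * y ^ m
/-- Right Ore predicate for powers of `y`. -/
def RO {R : Type*} [Ring R] (y r : R) : Prop := ∀ m : ℕ, ∃ N : ℕ, ∃ r' : R, r * y ^ N = y ^ m * r'

lemma qpow {y z : R} {e : k} (he : y * z = e • (z * y)) (N : ℕ) :
    y ^ N * z = e ^ N • (z * y ^ N) := by
  induction N with
  | zero => simp
  | succ N ih =>
    rw [pow_succ, mul_assoc, he, mul_smul_comm, ← mul_assoc, ih, smul_mul_assoc, smul_smul,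
      mul_assoc, ← pow_succ, ← pow_succ']

lemma qpow' {y z : R} {e : k} (he0 : e ≠ 0) (he : y * z = e • (z * y)) (N : ℕ) :
    z * y ^ N = (e ^ N)⁻¹ • (y ^ N * z) := by
  rw [qpow he, smul_smul, inv_mul_cancel₀ (pow_ne_zero _ he0), one_smul]

lemma LO_b (hq : q ≠ 0) (h : QM q t) {K L : Finset (Fin n)} (hc : K.card = L.card)
    (hD : Dm q t K L ≠ 0) {i b : Fin n} (hi' : i ∈ K) (hb : b ∉ L) : LO (Dm q t K L) (t i b) := by
  intro m
  obtain ⟨κ, hκ, h1⟩ := Dm_mul_t_out hq h hc hb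
  have h2 : ∀ c ∈ L, ∃ e : k, _ := fun c hcL => qcomm hq h hc hD hb hcL
  choose! e he using h2
  refine ⟨m + 1, ∑ c ∈ L, κ c • (t i c * (e c ^ m • yy q t K L b c)), ?_⟩
  rw [pow_succ, mul_assoc, h1 i hi', Finset.mul_sum, Finset.sum_mul]
  refine Finset.sum_congr rfl fun c hcL => ?_
  rw [mul_smul_comm, ← mul_assoc, ((Dm_central hq h hc hi' hcL).pow_left m).eq, mul_assoc,
    qpow (he c hcL).2]
  simp only [mul_smul_comm, smul_mul_assoc, mul_assoc]

lemma RO_b (hq : q ≠ 0) (h : QM q t) {K L : Finset (Fin n)} (hc : K.card = L.card)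
    (hD : Dm q t K L ≠ 0) {i b : Fin n} (hi' : i ∈ K) (hb : b ∉ L) : RO (Dm q t K L) (t i b) := by
  intro m
  obtain ⟨d, hd, h1⟩ := t_mul_Dm_out (K := K) hq h hb
  obtain ⟨s, h1⟩ := h1 i
  rw [if_pos hi', zero_sub] at h1
  have h2 : ∀ c ∈ L, ∃ e : k, _ := fun c hcL => qcomm hq h hc hD hb hcL
  choose! e he using h2
  refine ⟨m + 1, -∑ c ∈ L, d c • ((e c ^ m)⁻¹ • (t i c * yy q t K L b c)), ?_⟩
  rw [pow_succ', ← mul_assoc, h1, neg_mul, mul_neg, Finset.mul_sum, Finset.sum_mul]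
  congr 1
  refine Finset.sum_congr rfl fun c hcL => ?_
  rw [smul_mul_assoc, mul_assoc, qpow' (he c hcL).1 (he c hcL).2, mul_smul_comm, ← mul_assoc,
    ← ((Dm_central hq h hc hi' hcL).pow_left m).eq, mul_assoc]
  simp only [mul_smul_comm]

lemma LO_a {y r : R} (h : Commute y r) : LO y r := fun m => ⟨m, r, (h.pow_left m).eq⟩
lemma RO_a {y r : R} (h : Commute y r) : RO y r := fun m => ⟨m, r, (h.pow_left m).eq.symm⟩

open MulOpposite in
lemma LO_op {y r : R} (h : LO (op y) (op r)) : RO y r := fun m => by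
  obtain ⟨N, r', h⟩ := h m
  exact ⟨N, unop r', by simpa using congrArg unop h⟩

open MulOpposite in
lemma RO_op {y r : R} (h : RO (op y) (op r)) : LO y r := fun m => by
  obtain ⟨N, r', h⟩ := h m
  exact ⟨N, unop r', by simpa using congrArg unop h⟩

lemma RO_add {y r s : R} (hr : RO y r) (hs : RO y s) : RO y (r + s) := fun m => by
  obtain ⟨N, r', h⟩ := hr m
  obtain ⟨M, s', h'⟩ := hs m
  refine ⟨N + M, r' * y ^ M + s' * y ^ N, ?_⟩
  rw [add_mul, pow_add, ← mul_assoc, h, ← pow_add, add_comm N M, pow_add, ← mul_assoc, h',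
    mul_add, mul_assoc, mul_assoc]

lemma RO_mul {y r s : R} (hr : RO y r) (hs : RO y s) : RO y (r * s) := fun m => by
  obtain ⟨N, r', h⟩ := hr m
  obtain ⟨M, s', h'⟩ := hs N
  exact ⟨M, r' * s', by rw [mul_assoc, h', ← mul_assoc, h, mul_assoc]⟩

lemma LO_add {y r s : R} (hr : LO y r) (hs : LO y s) : LO y (r + s) := fun m => by
  obtain ⟨N, r', h⟩ := hr m
  obtain ⟨M, s', h'⟩ := hs m
  refine ⟨M + N, y ^ M * r' + y ^ N * s', ?_⟩
  rw [mul_add, pow_add, mul_assoc, h, ← pow_add, add_comm M N, pow_add, mul_assoc, h',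
    add_mul, mul_assoc, mul_assoc]

lemma LO_mul {y r s : R} (hr : LO y r) (hs : LO y s) : LO y (r * s) := fun m => by
  obtain ⟨M, s', h'⟩ := hs m
  obtain ⟨N, r', h⟩ := hr M
  exact ⟨N, r' * s', by rw [← mul_assoc, h, mul_assoc, h', mul_assoc]⟩

lemma RO_smul {y r : R} (c : k) (hr : RO y r) : RO y (c • r) := fun m => by
  obtain ⟨N, r', h⟩ := hr m
  exact ⟨N, c • r', by rw [smul_mul_assoc, h, mul_smul_comm]⟩

lemma RO_sum {ι : Type*} {y : R} (S : Finset ι) (f : ι → R) (h : ∀ c ∈ S, RO y (f c)) :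
    RO y (∑ c ∈ S, f c) := by
  refine Finset.sum_induction _ _ (fun _ _ => RO_add) (RO_a (by simp)) h

lemma LO_c (hq : q ≠ 0) (h : QM q t) {K L : Finset (Fin n)} (hc : K.card = L.card)
    (hD : Dm q t K L ≠ 0) {i b : Fin n} (hi' : i ∉ K) (hb : b ∈ L) : LO (Dm q t K L) (t i b) := by
  have e : Dm q (opt t) (rv L) (rv K) = MulOpposite.op (Dm q t K L) := by
    rw [Dm_op h, rv_rv, rv_rv]
  have := RO_b hq (QM.opq h) (K := rv L) (L := rv K) (by simp [hc]) (by rw [e]; simpa using hD)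
    (i := b.rev) (b := i.rev) (by simpa) (by simpa)
  rw [e, opt, Fin.rev_rev, Fin.rev_rev] at this
  exact RO_op this

lemma RO_c (hq : q ≠ 0) (h : QM q t) {K L : Finset (Fin n)} (hc : K.card = L.card)
    (hD : Dm q t K L ≠ 0) {i b : Fin n} (hi' : i ∉ K) (hb : b ∈ L) : RO (Dm q t K L) (t i b) := by
  have e : Dm q (opt t) (rv L) (rv K) = MulOpposite.op (Dm q t K L) := by
    rw [Dm_op h, rv_rv, rv_rv]
  have := LO_b hq (QM.opq h) (K := rv L) (L := rv K) (by simp [hc]) (by rw [e]; simpa using hD)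
    (i := b.rev) (b := i.rev) (by simpa) (by simpa)
  rw [e, opt, Fin.rev_rev, Fin.rev_rev] at this
  exact LO_op this

lemma RO_d (hq : q ≠ 0) (h : QM q t) {K L : Finset (Fin n)} (hc : K.card = L.card)
    (hD : Dm q t K L ≠ 0) {i b : Fin n} (hi' : i ∉ K) (hb : b ∉ L) : RO (Dm q t K L) (t i b) := by
  set y := Dm q t K L with hy
  suffices hs : RO y (t i b * y) by
    intro m
    obtain ⟨N, r', hN⟩ := hs m
    exact ⟨N + 1, r', by rw [pow_succ', ← mul_assoc, hN]⟩
  obtain ⟨d, hd, h1⟩ := t_mul_Dm_out (K := K) hq h hb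
  obtain ⟨s, h1⟩ := h1 i
  rw [if_neg hi', sub_eq_add_neg, ← Finset.sum_neg_distrib] at h1
  rw [h1]
  refine RO_add (RO_smul s (RO_a ?_)) (RO_sum _ _ fun c hcL => ?_)
  · refine (commute_Dm fun i' hi'' j' hj' => ?_).symm
    refine Dm_central hq h ?_ (by simp [hi'']) (by simp [hj'])
    rw [Finset.card_insert_of_notMem hi', Finset.card_insert_of_notMem hb, hc]
  · rw [← neg_smul]
    refine RO_smul _ (RO_mul (RO_c hq h hc hD hi' hcL) ?_)
    obtain ⟨e, he0, he⟩ := qcomm hq h hc hD hb hcL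
    exact fun m => ⟨m, (e ^ m)⁻¹ • yy q t K L b c, by rw [qpow' he0 he, mul_smul_comm]⟩

theorem RO_gen (hq : q ≠ 0) (h : QM q t) {K L : Finset (Fin n)} (hc : K.card = L.card)
    (hD : Dm q t K L ≠ 0) (i b : Fin n) : RO (Dm q t K L) (t i b) := by
  by_cases hi' : i ∈ K <;> by_cases hb : b ∈ L
  · exact RO_a (Dm_central hq h hc hi' hb)
  · exact RO_b hq h hc hD hi' hb
  · exact RO_c hq h hc hD hi' hb
  · exact RO_d hq h hc hD hi' hb

theorem LO_gen (hq : q ≠ 0) (h : QM q t) {K L : Finset (Fin n)} (hc : K.card = L.card)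
    (hD : Dm q t K L ≠ 0) (i b : Fin n) : LO (Dm q t K L) (t i b) := by
  have e : Dm q (opt t) (rv L) (rv K) = MulOpposite.op (Dm q t K L) := by
    rw [Dm_op h, rv_rv, rv_rv]
  have := RO_gen hq (QM.opq h) (K := rv L) (L := rv K) (by simp [hc]) (by rw [e]; simpa using hD)
    b.rev i.rev
  rw [e, opt, Fin.rev_rev, Fin.rev_rev] at this
  exact RO_op this

end comm
end QMin
namespace QMin
section ore
open Polynomial
variable {k : Type*} [Field k] {A B : Type*} [Ring A] [Algebra k A] [Ring B] [Algebra k B]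

/-- The operator of left multiplication by the Ore variable. -/
def Xop (σ : A →ₐ[k] A) (δ : A →ₗ[k] A) : Module.End k (ℕ → A) where
  toFun p i := match i with
    | 0 => δ (p 0)
    | (i+1) => δ (p (i+1)) + σ (p i)
  map_add' p p' := by
    funext i; cases i <;> simp; abel
  map_smul' c p := by
    funext i; cases i <;> simp

lemma Xop_zero (σ : A →ₐ[k] A) (δ : A →ₗ[k] A) (p : ℕ → A) : Xop σ δ p 0 = δ (p 0) := rfl
lemma Xop_succ (σ : A →ₐ[k] A) (δ : A →ₗ[k] A) (p : ℕ → A) (i : ℕ) :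
  Xop σ δ p (i + 1) = δ (p (i + 1)) + σ (p i) := rfl

lemma Xop_pow (σ : A →ₐ[k] A) (δ : A →ₗ[k] A) (p : ℕ → A) (d : ℕ) (hp : ∀ i, d < i → p i = 0)
    (j : ℕ) : (∀ i, j + d < i → ((Xop σ δ) ^ j) p i = 0) ∧
      ((Xop σ δ) ^ j) p (j + d) = (σ ^ j) (p d) := by
  induction j with
  | zero => simpa using hp
  | succ j ih =>
    obtain ⟨h1, h2⟩ := ih
    rw [pow_succ', pow_succ']
    refine ⟨?_, ?_⟩
    · intro i hi
      obtain ⟨i, rfl⟩ : ∃ i', i = i' + 1 := ⟨i - 1, by omega⟩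
      rw [Module.End.mul_apply, Xop_succ, h1 _ (by omega), h1 _ (by omega)]; simp
    · rw [Module.End.mul_apply, show j + 1 + d = (j + d) + 1 by omega, Xop_succ, h1 _ (by omega), h2]
      simp

lemma Xop_pow_single (σ : A →ₐ[k] A) (δ : A →ₗ[k] A) (hδ1 : δ 1 = 0) (j : ℕ) :
    ((Xop σ δ) ^ j) (Pi.single 0 1) = Pi.single j 1 := by
  induction j with
  | zero => simp
  | succ j ih =>
    rw [pow_succ', Module.End.mul_apply, ih]
    funext i
    cases i with
    | zero =>
      rw [Xop_zero]
      rcases Nat.eq_zero_or_pos j with rfl | hj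
      · simp [hδ1]
      · simp [Pi.single_apply, hj.ne]
    | succ i =>
      rw [Xop_succ]
      by_cases h : i = j
      · subst h; simp
      · by_cases h' : i + 1 = j
        · subst h'; simp [hδ1]
        · simp [Pi.single_apply, h, h']

theorem ore_domain [NoZeroDivisors A] (f : A →ₐ[k] B) (x : B) (σ : A →ₐ[k] A) (δ : A →ₗ[k] A)
    (hσ : Function.Injective σ) (hδ1 : δ 1 = 0)
    (hx : ∀ a, x * f a = f (σ a) * x + f (δ a))
    (hgen : Algebra.adjoin k (Set.range f ∪ {x}) = ⊤)
    (ρ : B →ₐ[k] Module.End k (ℕ → A)) (hρf : ∀ a p i, ρ (f a) p i = a * p i)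
    (hρx : ρ x = Xop σ δ) : NoZeroDivisors B := by
  set ev : A[X] → B := fun p => p.eval₂ (f : A →+* B) x with hev
  have hadd : ∀ p p', ev (p + p') = ev p + ev p' := fun p p' => eval₂_add _ _
  have hmon : ∀ i a, ev (monomial i a) = f a * x ^ i := fun i a => eval₂_monomial _ _
  have hsurj : ∀ b : B, ∀ p, ∃ p', ev p' = b * ev p := by
    intro b
    have hb : b ∈ Algebra.adjoin k (Set.range f ∪ {x}) := by rw [hgen]; trivial
    have hf : ∀ a p, ∃ p', ev p' = f a * ev p := by
      intro a p
      induction p using Polynomial.induction_on' with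
      | add p p' h h' =>
        obtain ⟨r, hr⟩ := h; obtain ⟨r', hr'⟩ := h'
        exact ⟨r + r', by rw [hadd, hadd, hr, hr', mul_add]⟩
      | monomial i c => exact ⟨monomial i (a * c), by rw [hmon, hmon, map_mul, mul_assoc]⟩
    induction hb using Algebra.adjoin_induction with
    | mem b hb =>
      rcases hb with ⟨a, rfl⟩ | rfl
      · exact hf a
      · intro p
        induction p using Polynomial.induction_on' with
        | add p p' h h' =>
          obtain ⟨r, hr⟩ := h; obtain ⟨r', hr'⟩ := h'
          exact ⟨r + r', by rw [hadd, hadd, hr, hr', mul_add]⟩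
        | monomial i c =>
          exact ⟨monomial (i+1) (σ c) + monomial i (δ c), by
            rw [hadd, hmon, hmon, hmon, ← mul_assoc, hx, add_mul, pow_succ', mul_assoc]⟩
    | algebraMap r =>
      intro p
      obtain ⟨p', h⟩ := hf (algebraMap k A r) p
      exact ⟨p', by rw [h, AlgHom.commutes]⟩
    | add b b' _ _ h h' =>
      intro p
      obtain ⟨r, hr⟩ := h p; obtain ⟨r', hr'⟩ := h' p
      exact ⟨r + r', by rw [hadd, hr, hr', add_mul]⟩
    | mul b b' _ _ h h' =>
      intro p
      obtain ⟨r', hr'⟩ := h' p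
      obtain ⟨r, hr⟩ := h r'
      exact ⟨r, by rw [hr, hr', mul_assoc]⟩
  have hsurj' : ∀ b : B, ∃ p, ev p = b := by
    intro b
    obtain ⟨p, hp⟩ := hsurj b (monomial 0 1)
    exact ⟨p, by rw [hp, hmon]; simp⟩
  have hact : ∀ p v i, ρ (ev p) v i =
      ∑ j ∈ Finset.range (p.natDegree + 1), p.coeff j * ((Xop σ δ) ^ j) v i := by
    intro p v i
    simp only [hev, eval₂_eq_sum_range, map_sum, map_mul, map_pow, hρx]
    rw [LinearMap.sum_apply, Finset.sum_apply]
    refine Finset.sum_congr rfl fun j _ => ?_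
    rw [Module.End.mul_apply]
    exact hρf _ _ _
  have hone : ∀ p : A[X], ρ (ev p) (Pi.single 0 1) = fun i => p.coeff i := by
    intro p; funext i
    rw [hact]
    simp only [Xop_pow_single σ δ hδ1, Pi.single_apply, mul_ite, mul_one, mul_zero]
    rw [Finset.sum_ite_eq]
    split_ifs with h
    · rfl
    · rw [Finset.mem_range] at h
      exact (coeff_eq_zero_of_natDegree_lt (by omega)).symm
  refine ⟨fun {b b'} hbb => ?_⟩
  obtain ⟨p, rfl⟩ := hsurj' b
  obtain ⟨p', rfl⟩ := hsurj' b'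
  by_contra hcon
  push Not at hcon
  have hp0 : p ≠ 0 := by rintro rfl; exact hcon.1 (by simp [hev])
  have hp0' : p' ≠ 0 := by rintro rfl; exact hcon.2 (by simp [hev])
  have h1 : ρ (ev p) (fun i => p'.coeff i) = 0 := by
    rw [← hone, ← Module.End.mul_apply, ← map_mul, hbb]; simp
  have h2 := congrFun h1 (p.natDegree + p'.natDegree)
  have hX := fun j => Xop_pow σ δ (fun i => p'.coeff i) p'.natDegree
    (fun i hi => coeff_eq_zero_of_natDegree_lt hi) j
  rw [hact, Finset.sum_range_succ, Finset.sum_eq_zero, zero_add, (hX _).2] at h2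
  · rcases mul_eq_zero.1 h2 with h3 | h3
    · exact hp0 (leadingCoeff_eq_zero.1 h3)
    · have hinj : ∀ j a, (σ ^ j) a = 0 → a = 0 := by
        intro j
        induction j with
        | zero => intro a h; simpa using h
        | succ j ih =>
          intro a h
          rw [pow_succ] at h
          have this : σ a = 0 := ih _ h
          exact hσ (by rw [this, map_zero])
      exact hp0' (leadingCoeff_eq_zero.1 (hinj _ _ h3))
  · intro j hj
    rw [Finset.mem_range] at hj
    rw [(hX j).1 _ (by omega), mul_zero]

end ore
end QMin
namespace QMin
section tower

structure QS {k : Type*} [Field k] (q : k) {n : ℕ} (S : Fin n → Fin n → Prop) {R : Type*} [Ring R]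
    [Algebra k R] (t : Fin n → Fin n → R) : Prop where
  row : ∀ α γ δ : Fin n, γ < δ → S α δ → t α γ * t α δ = q • (t α δ * t α γ)
  col : ∀ α β γ : Fin n, α < β → S β γ → t α γ * t β γ = q • (t β γ * t α γ)
  cross : ∀ α β γ δ : Fin n, α < β → δ < γ → S β δ → t α γ * t β δ = t β δ * t α γ
  qcross : ∀ α β γ δ : Fin n, α < β → γ < δ → S β δ →
    t α γ * t β δ - t β δ * t α γ = (q - q⁻¹) • (t β γ * t α δ)
  zero : ∀ i j, ¬ S i j → t i j = 0

variable {k : Type*} [Field k] {q : k} {n : ℕ} {S : Fin n → Fin n → Prop} {A : Type*} [Ring A]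
    [Algebra k A] {t : Fin n → Fin n → A}

lemma QS.scale (h : QS q S t) (r s : Fin n → k) : QS q S (fun i j => (r i * s j) • t i j) where
  row α γ δ h1 h2 := by
    simp only [smul_mul_smul_comm]; rw [h.row α γ δ h1 h2, smul_comm]; congr 2; ring
  col α β γ h1 h2 := by
    simp only [smul_mul_smul_comm]; rw [h.col α β γ h1 h2, smul_comm]; congr 2; ring
  cross α β γ δ h1 h2 h3 := by
    simp only [smul_mul_smul_comm]; rw [h.cross α β γ δ h1 h2 h3]; congr 1; ring
  qcross α β γ δ h1 h2 h3 := by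
    simp only [smul_mul_smul_comm]
    rw [mul_comm (r β * s δ), ← smul_sub, h.qcross α β γ δ h1 h2 h3, smul_comm]; congr 2; ring
  zero i j hh := by simp [h.zero i j hh]

def tri (a b c : A) : Matrix (Fin 2) (Fin 2) A := !![a, b; 0, c]

lemma tri_mul (a b c a' b' c' : A) :
    tri a b c * tri a' b' c' = tri (a * a') (a * b' + b * c') (c * c') := by
  simp [tri]
lemma tri_sub (a b c a' b' c' : A) :
    tri a b c - tri a' b' c' = tri (a - a') (b - b') (c - c') := by
  ext i j; fin_cases i <;> fin_cases j <;> simp [tri]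
lemma tri_smul (s : k) (a b c : A) : s • tri a b c = tri (s • a) (s • b) (s • c) := by
  ext i j; fin_cases i <;> fin_cases j <;> simp [tri]

variable (q) in
def cc (b d i j : Fin n) : k := (if i = b then q⁻¹ else 1) * (if j = d then q⁻¹ else 1)

variable (q) in
def dl (t : Fin n → Fin n → A) (b d i j : Fin n) : A :=
  if i < b ∧ j < d then (-(q - q⁻¹)) • (t b j * t i d) else 0

lemma asc {x y z : A} (h : x * y = z) (w : A) : x * (y * w) = z * w := by rw [← mul_assoc, h]


lemma row' (hq : q ≠ 0) (h : QS q S t) {α γ δ : Fin n} (h1 : γ < δ) (h2 : S α δ) :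
    t α δ * t α γ = q⁻¹ • (t α γ * t α δ) := by
  rw [h.row α γ δ h1 h2, smul_smul, inv_mul_cancel₀ hq, one_smul]
lemma col' (hq : q ≠ 0) (h : QS q S t) {α β γ : Fin n} (h1 : α < β) (h2 : S β γ) :
    t β γ * t α γ = q⁻¹ • (t α γ * t β γ) := by
  rw [h.col α β γ h1 h2, smul_smul, inv_mul_cancel₀ hq, one_smul]
lemma cross' (h : QS q S t) {α β γ δ : Fin n} (h1 : α < β) (h2 : δ < γ) (h3 : S β δ) :
    t β δ * t α γ = t α γ * t β δ := (h.cross α β γ δ h1 h2 h3).symm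
lemma qcross' (h : QS q S t) {α β γ δ : Fin n} (h1 : α < β) (h2 : γ < δ) (h3 : S β δ) (h4 : S β γ) :
    t β δ * t α γ = t α γ * t β δ + (-(q - q⁻¹)) • (t α δ * t β γ) := by
  have := h.qcross α β γ δ h1 h2 h3
  rw [cross' h h1 h2 h4] at this
  rw [neg_smul, ← this]; abel
lemma cross1 (h : QS q S t) {α β γ δ : Fin n} (h1 : α < β) (h2 : δ < γ) (h3 : S β δ) :
    t β δ * t α γ = (1 : k) • (t α γ * t β δ) := by rw [one_smul, cross' h h1 h2 h3]
lemma row2 (hq : q ≠ 0) (h : QS q S t) {α γ δ : Fin n} (h1 : γ < δ) (h2 : S α δ) (w : A) :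
    t α δ * (t α γ * w) = q⁻¹ • (t α γ * (t α δ * w)) := by
  rw [asc (row' hq h h1 h2), smul_mul_assoc, mul_assoc]
lemma col2 (hq : q ≠ 0) (h : QS q S t) {α β γ : Fin n} (h1 : α < β) (h2 : S β γ) (w : A) :
    t β γ * (t α γ * w) = q⁻¹ • (t α γ * (t β γ * w)) := by
  rw [asc (col' hq h h1 h2), smul_mul_assoc, mul_assoc]
lemma cross2 (h : QS q S t) {α β γ δ : Fin n} (h1 : α < β) (h2 : δ < γ) (h3 : S β δ) (w : A) :
    t β δ * (t α γ * w) = (1 : k) • (t α γ * (t β δ * w)) := by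
  rw [one_smul, asc (cross' h h1 h2 h3), mul_assoc]
lemma qcross2 (h : QS q S t) {α β γ δ : Fin n} (h1 : α < β) (h2 : γ < δ) (h3 : S β δ) (h4 : S β γ)
    (w : A) :
    t β δ * (t α γ * w) = t α γ * (t β δ * w) + (-(q - q⁻¹)) • (t α δ * (t β γ * w)) := by
  rw [asc (qcross' h h1 h2 h3 h4), add_mul, smul_mul_assoc, mul_assoc, mul_assoc]

theorem QS.tri (hq : q ≠ 0) (h : QS q S t) {b d : Fin n}
    (hS : ∀ i j, S i j ↔ i < b ∨ (i = b ∧ j < d)) :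
    QS q S (fun i j => tri (cc q b d i j • t i j) (dl q t b d i j) (t i j)) := by
  have hsc := h.scale (fun i => if i = b then q⁻¹ else 1) (fun j => if j = d then q⁻¹ else 1)
  change QS q S (fun i j => cc q b d i j • t i j) at hsc
  constructor
  · intro α γ δ h1 h2
    simp only [tri_mul, tri_smul]
    rw [hsc.row α γ δ h1 h2, h.row α γ δ h1 h2]
    congr 1
    rw [hS] at h2
    rcases h2 with h2 | ⟨rfl, h2⟩
    · rcases lt_trichotomy γ d with hg | rfl | hg
      · rcases lt_trichotomy δ d with hd | rfl | hd
        · skip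
          simp only [cc, dl, hS, h1, h1.ne, h1.ne', h1.not_gt, h2, h2.ne, h2.ne', h2.not_gt, hg, hg.ne, hg.ne', hg.not_gt, hd, hd.ne, hd.ne', hd.not_gt, and_self, and_true, true_and, and_false, false_and, true_or, or_true, or_false, lt_irrefl, eq_self, false_or, if_true, if_false, mul_one, one_mul, one_smul, mul_zero, zero_mul, add_zero, zero_add, smul_zero, smul_add, mul_add, add_mul, mul_assoc, smul_smul, mul_smul_comm, smul_mul_assoc, row' hq h, col' hq h, cross1 h, qcross' h, row2 hq h, col2 hq h, cross2 h, qcross2 h]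
          match_scalars <;> field_simp <;> ring
        · skip
          simp only [cc, dl, hS, h1, h1.ne, h1.ne', h1.not_gt, h2, h2.ne, h2.ne', h2.not_gt, and_self, and_true, true_and, and_false, false_and, true_or, or_true, or_false, lt_irrefl, eq_self, false_or, if_true, if_false, mul_one, one_mul, one_smul, mul_zero, zero_mul, add_zero, zero_add, smul_zero, smul_add, mul_add, add_mul, mul_assoc, smul_smul, mul_smul_comm, smul_mul_assoc, row' hq h, col' hq h, cross1 h, qcross' h, row2 hq h, col2 hq h, cross2 h, qcross2 h]
          match_scalars <;> field_simp <;> ring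
        · skip
          simp only [cc, dl, hS, h1, h1.ne, h1.ne', h1.not_gt, h2, h2.ne, h2.ne', h2.not_gt, hg, hg.ne, hg.ne', hg.not_gt, hd, hd.ne, hd.ne', hd.not_gt, and_self, and_true, true_and, and_false, false_and, true_or, or_true, or_false, lt_irrefl, eq_self, false_or, if_true, if_false, mul_one, one_mul, one_smul, mul_zero, zero_mul, add_zero, zero_add, smul_zero, smul_add, mul_add, add_mul, mul_assoc, smul_smul, mul_smul_comm, smul_mul_assoc, row' hq h, col' hq h, cross1 h, qcross' h, row2 hq h, col2 hq h, cross2 h, qcross2 h]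
          match_scalars <;> field_simp <;> ring
      · simp [dl, h1.not_gt]
      · simp [dl, hg.not_gt, (hg.trans h1).not_gt]
    · simp [dl]
  · intro α β γ h1 h2
    simp only [tri_mul, tri_smul]
    rw [hsc.col α β γ h1 h2, h.col α β γ h1 h2]
    congr 1
    rw [hS] at h2
    rcases h2 with h2 | ⟨rfl, h2⟩
    · have h3 := h1.trans h2
      rcases lt_or_ge γ d with hg | hg
      · skip
        simp only [cc, dl, hS, h1, h1.ne, h1.ne', h1.not_gt, h2, h2.ne, h2.ne', h2.not_gt, h3, h3.ne, h3.ne', h3.not_gt, hg, hg.ne, hg.ne', hg.not_gt, and_self, and_true, true_and, and_false, false_and, true_or, or_true, or_false, lt_irrefl, eq_self, false_or, if_true, if_false, mul_one, one_mul, one_smul, mul_zero, zero_mul, add_zero, zero_add, smul_zero, smul_add, mul_add, add_mul, mul_assoc, smul_smul, mul_smul_comm, smul_mul_assoc, row' hq h, col' hq h, cross1 h, qcross' h, row2 hq h, col2 hq h, cross2 h, qcross2 h]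
        match_scalars <;> field_simp <;> ring
      · simp [dl, hg.not_gt]
    · skip
      simp only [cc, dl, hS, h1, h1.ne, h1.ne', h1.not_gt, h2, h2.ne, h2.ne', h2.not_gt, and_self, and_true, true_and, and_false, false_and, true_or, or_true, or_false, lt_irrefl, eq_self, false_or, if_true, if_false, mul_one, one_mul, one_smul, mul_zero, zero_mul, add_zero, zero_add, smul_zero, smul_add, mul_add, add_mul, mul_assoc, smul_smul, mul_smul_comm, smul_mul_assoc, row' hq h, col' hq h, cross1 h, qcross' h, row2 hq h, col2 hq h, cross2 h, qcross2 h]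
      match_scalars <;> field_simp <;> ring
  · intro α β γ δ h1 h2 h3
    simp only [tri_mul, tri_smul]
    rw [hsc.cross α β γ δ h1 h2 h3, h.cross α β γ δ h1 h2 h3]
    congr 1
    rw [hS] at h3
    rcases h3 with h3 | ⟨rfl, h3⟩
    · have h4 := h1.trans h3
      rcases lt_trichotomy δ d with hd | rfl | hd
      · rcases lt_trichotomy γ d with hg | rfl | hg
        · skip
          simp only [cc, dl, hS, h1, h1.ne, h1.ne', h1.not_gt, h2, h2.ne, h2.ne', h2.not_gt, h3, h3.ne, h3.ne', h3.not_gt, h4, h4.ne, h4.ne', h4.not_gt, hd, hd.ne, hd.ne', hd.not_gt, hg, hg.ne, hg.ne', hg.not_gt, and_self, and_true, true_and, and_false, false_and, true_or, or_true, or_false, lt_irrefl, eq_self, false_or, if_true, if_false, mul_one, one_mul, one_smul, mul_zero, zero_mul, add_zero, zero_add, smul_zero, smul_add, mul_add, add_mul, mul_assoc, smul_smul, mul_smul_comm, smul_mul_assoc, row' hq h, col' hq h, cross1 h, qcross' h, row2 hq h, col2 hq h, cross2 h, qcross2 h]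
          match_scalars <;> field_simp <;> ring
        · skip
          simp only [cc, dl, hS, h1, h1.ne, h1.ne', h1.not_gt, h2, h2.ne, h2.ne', h2.not_gt, h3, h3.ne, h3.ne', h3.not_gt, h4, h4.ne, h4.ne', h4.not_gt, and_self, and_true, true_and, and_false, false_and, true_or, or_true, or_false, lt_irrefl, eq_self, false_or, if_true, if_false, mul_one, one_mul, one_smul, mul_zero, zero_mul, add_zero, zero_add, smul_zero, smul_add, mul_add, add_mul, mul_assoc, smul_smul, mul_smul_comm, smul_mul_assoc, row' hq h, col' hq h, cross1 h, qcross' h, row2 hq h, col2 hq h, cross2 h, qcross2 h]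
        · skip
          simp only [cc, dl, hS, h1, h1.ne, h1.ne', h1.not_gt, h2, h2.ne, h2.ne', h2.not_gt, h3, h3.ne, h3.ne', h3.not_gt, h4, h4.ne, h4.ne', h4.not_gt, hd, hd.ne, hd.ne', hd.not_gt, hg, hg.ne, hg.ne', hg.not_gt, and_self, and_true, true_and, and_false, false_and, true_or, or_true, or_false, lt_irrefl, eq_self, false_or, if_true, if_false, mul_one, one_mul, one_smul, mul_zero, zero_mul, add_zero, zero_add, smul_zero, smul_add, mul_add, add_mul, mul_assoc, smul_smul, mul_smul_comm, smul_mul_assoc, row' hq h, col' hq h, cross1 h, qcross' h, row2 hq h, col2 hq h, cross2 h, qcross2 h]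
      · simp [dl, h2.not_gt]
      · simp [dl, hd.not_gt, (hd.trans h2).not_gt]
    · rcases lt_trichotomy γ d with hg | rfl | hg
      · skip
        simp only [cc, dl, hS, h1, h1.ne, h1.ne', h1.not_gt, h2, h2.ne, h2.ne', h2.not_gt, h3, h3.ne, h3.ne', h3.not_gt, hg, hg.ne, hg.ne', hg.not_gt, and_self, and_true, true_and, and_false, false_and, true_or, or_true, or_false, lt_irrefl, eq_self, false_or, if_true, if_false, mul_one, one_mul, one_smul, mul_zero, zero_mul, add_zero, zero_add, smul_zero, smul_add, mul_add, add_mul, mul_assoc, smul_smul, mul_smul_comm, smul_mul_assoc, row' hq h, col' hq h, cross1 h, qcross' h, row2 hq h, col2 hq h, cross2 h, qcross2 h]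
      · simp [dl]
      · simp [dl, hg.not_gt]
  · intro α β γ δ h1 h2 h3
    simp only [tri_mul, tri_smul, tri_sub]
    rw [hsc.qcross α β γ δ h1 h2 h3, h.qcross α β γ δ h1 h2 h3]
    congr 1
    rw [hS] at h3
    rcases h3 with h3 | ⟨rfl, h3⟩
    · have h4 := h1.trans h3
      rcases lt_trichotomy γ d with hg | rfl | hg
      · rcases lt_trichotomy δ d with hd | rfl | hd
        · skip
          simp only [cc, dl, hS, h1, h1.ne, h1.ne', h1.not_gt, h2, h2.ne, h2.ne', h2.not_gt, h3, h3.ne, h3.ne', h3.not_gt, h4, h4.ne, h4.ne', h4.not_gt, hg, hg.ne, hg.ne', hg.not_gt, hd, hd.ne, hd.ne', hd.not_gt, and_self, and_true, true_and, and_false, false_and, true_or, or_true, or_false, lt_irrefl, eq_self, false_or, if_true, if_false, mul_one, one_mul, one_smul, mul_zero, zero_mul, add_zero, zero_add, smul_zero, smul_add, mul_add, add_mul, mul_assoc, smul_smul, mul_smul_comm, smul_mul_assoc, row' hq h, col' hq h, cross1 h, qcross' h, row2 hq h, col2 hq h, cross2 h, qcross2 h]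
          match_scalars <;> field_simp <;> ring
        · skip
          simp only [cc, dl, hS, h1, h1.ne, h1.ne', h1.not_gt, h2, h2.ne, h2.ne', h2.not_gt, h3, h3.ne, h3.ne', h3.not_gt, h4, h4.ne, h4.ne', h4.not_gt, and_self, and_true, true_and, and_false, false_and, true_or, or_true, or_false, lt_irrefl, eq_self, false_or, if_true, if_false, mul_one, one_mul, one_smul, mul_zero, zero_mul, add_zero, zero_add, smul_zero, smul_add, mul_add, add_mul, mul_assoc, smul_smul, mul_smul_comm, smul_mul_assoc, row' hq h, col' hq h, cross1 h, qcross' h, row2 hq h, col2 hq h, cross2 h, qcross2 h]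
          match_scalars <;> field_simp <;> ring
        · skip
          simp only [cc, dl, hS, h1, h1.ne, h1.ne', h1.not_gt, h2, h2.ne, h2.ne', h2.not_gt, h3, h3.ne, h3.ne', h3.not_gt, h4, h4.ne, h4.ne', h4.not_gt, hg, hg.ne, hg.ne', hg.not_gt, hd, hd.ne, hd.ne', hd.not_gt, and_self, and_true, true_and, and_false, false_and, true_or, or_true, or_false, lt_irrefl, eq_self, false_or, if_true, if_false, mul_one, one_mul, one_smul, mul_zero, zero_mul, add_zero, zero_add, smul_zero, smul_add, mul_add, add_mul, mul_assoc, smul_smul, mul_smul_comm, smul_mul_assoc, row' hq h, col' hq h, cross1 h, qcross' h, row2 hq h, col2 hq h, cross2 h, qcross2 h]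
          match_scalars <;> field_simp <;> ring
      · simp [dl, h2.not_gt]
      · simp [dl, hg.not_gt, (hg.trans h2).not_gt]
    · have hg := h2.trans h3
      simp only [cc, dl, hS, h1, h1.ne, h1.ne', h1.not_gt, h2, h2.ne, h2.ne', h2.not_gt, h3, h3.ne, h3.ne', h3.not_gt, hg, hg.ne, hg.ne', hg.not_gt, and_self, and_true, true_and, and_false, false_and, true_or, or_true, or_false, lt_irrefl, eq_self, false_or, if_true, if_false, mul_one, one_mul, one_smul, mul_zero, zero_mul, add_zero, zero_add, smul_zero, smul_add, mul_add, add_mul, mul_assoc, smul_smul, mul_smul_comm, smul_mul_assoc, row' hq h, col' hq h, cross1 h, qcross' h, row2 hq h, col2 hq h, cross2 h, qcross2 h]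
      match_scalars <;> field_simp <;> ring
  · intro i j hij
    have hz : t i j = 0 := h.zero i j hij
    have : ¬ i < b := fun hh => hij ((hS i j).2 (Or.inl hh))
    ext x y; fin_cases x <;> fin_cases y <;> simp [QMin.tri, dl, hz, this]

end tower
end QMin
namespace QMin
section pres

lemma QS.map {k : Type*} [Field k] {q : k} {n : ℕ} {S : Fin n → Fin n → Prop} {A B : Type*} [Ring A]
    [Algebra k A] [Ring B] [Algebra k B] {t : Fin n → Fin n → A} (h : QS q S t) (f : A →ₐ[k] B) :
    QS q S (fun i j => f (t i j)) where
  row α γ δ h1 h2 := by simp only [← map_mul, ← map_smul, h.row α γ δ h1 h2]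
  col α β γ h1 h2 := by simp only [← map_mul, ← map_smul, h.col α β γ h1 h2]
  cross α β γ δ h1 h2 h3 := by simp only [← map_mul, h.cross α β γ δ h1 h2 h3]
  qcross α β γ δ h1 h2 h3 := by
    simp only [← map_mul, ← map_sub, ← map_smul, h.qcross α β γ δ h1 h2 h3]
  zero i j hh := by simp [h.zero i j hh]

lemma QS.extend {k : Type*} [Field k] {q : k} (hq : q ≠ 0) {n : ℕ} {S S' : Fin n → Fin n → Prop}
    {A : Type*} [Ring A] [Algebra k A] {t : Fin n → Fin n → A} (h : QS q S t) {b d : Fin n}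
    (hS : ∀ i j, S i j ↔ i < b ∨ (i = b ∧ j < d)) (hS' : ∀ i j, S' i j ↔ S i j ∨ (i = b ∧ j = d))
    (x : A) (hx : ∀ i j, S i j → x * t i j = cc q b d i j • (t i j * x) + dl q t b d i j) :
    QS q S' (fun i j => if i = b ∧ j = d then x else t i j) := by
  constructor
  · intro α γ δ h1 h2
    rw [hS'] at h2
    rcases h2 with h2 | ⟨rfl, rfl⟩
    · have e1 : ¬ (α = b ∧ δ = d) := by rw [hS] at h2; omega
      have e2 : ¬ (α = b ∧ γ = d) := by rw [hS] at h2; omega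
      simp only [e1, e2, if_false]; exact h.row α γ δ h1 h2
    · have := hx α γ ((hS _ _).2 (Or.inr ⟨rfl, h1⟩))
      simp [cc, dl, h1.ne] at this
      simp [h1.ne, this, smul_smul, hq]
  · intro α β γ h1 h2
    rw [hS'] at h2
    rcases h2 with h2 | ⟨rfl, rfl⟩
    · have e1 : ¬ (β = b ∧ γ = d) := by rw [hS] at h2; omega
      have e2 : ¬ (α = b ∧ γ = d) := by rw [hS] at h2; omega
      simp only [e1, e2, if_false]; exact h.col α β γ h1 h2
    · have := hx α γ ((hS _ _).2 (Or.inl h1))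
      simp [cc, dl, h1.ne] at this
      simp [h1.ne, this, smul_smul, hq]
  · intro α β γ δ h1 h2 h3
    rw [hS'] at h3
    rcases h3 with h3 | ⟨rfl, rfl⟩
    · have e1 : ¬ (β = b ∧ δ = d) := by rw [hS] at h3; omega
      have e2 : ¬ (α = b ∧ γ = d) := by rw [hS] at h3; omega
      simp only [e1, e2, if_false]; exact h.cross α β γ δ h1 h2 h3
    · have := hx α γ ((hS _ _).2 (Or.inl h1))
      simp [cc, dl, h1.ne, h2.ne', h2.not_gt] at this
      simp [h1.ne, this]
  · intro α β γ δ h1 h2 h3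
    rw [hS'] at h3
    rcases h3 with h3 | ⟨rfl, rfl⟩
    · have e1 : ¬ (β = b ∧ δ = d) := by rw [hS] at h3; omega
      have e2 : ¬ (α = b ∧ γ = d) := by rw [hS] at h3; omega
      have e3 : ¬ (β = b ∧ γ = d) := by rw [hS] at h3; omega
      have e4 : ¬ (α = b ∧ δ = d) := by rw [hS] at h3; omega
      simp only [e1, e2, e3, e4, if_false]; exact h.qcross α β γ δ h1 h2 h3
    · have := hx α γ ((hS _ _).2 (Or.inl h1))
      simp only [cc, dl, h1.ne, h2.ne, h1, h2, and_self, if_true, if_false, mul_one, one_smul] at this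
      simp only [h1.ne, h2.ne, and_self, and_false, false_and, if_true, if_false, this, neg_smul]
      abel
  · intro i j hij
    rw [hS'] at hij
    push Not at hij
    have : ¬ (i = b ∧ j = d) := fun hh => hij.2 hh.1 hh.2
    simp only [this, if_false]
    exact h.zero i j hij.1

lemma QS.restrict {k : Type*} [Field k] {q : k} {n : ℕ} {S S' : Fin n → Fin n → Prop}
    {A : Type*} [Ring A] [Algebra k A] {t : Fin n → Fin n → A} (h : QS q S' t) {b d : Fin n}
    [∀ i j, Decidable (S i j)]
    (hS : ∀ i j, S i j ↔ i < b ∨ (i = b ∧ j < d)) (hS' : ∀ i j, S' i j ↔ S i j ∨ (i = b ∧ j = d)) :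
    QS q S (fun i j => if S i j then t i j else 0) := by
  constructor
  · intro α γ δ h1 h2
    have e : S α γ := by rw [hS] at *; omega
    simp only [h2, e, if_true]; exact h.row α γ δ h1 ((hS' _ _).2 (Or.inl h2))
  · intro α β γ h1 h2
    have e : S α γ := by rw [hS] at *; omega
    simp only [h2, e, if_true]; exact h.col α β γ h1 ((hS' _ _).2 (Or.inl h2))
  · intro α β γ δ h1 h2 h3
    have e : S α γ := by rw [hS] at *; omega
    simp only [h3, e, if_true]; exact h.cross α β γ δ h1 h2 ((hS' _ _).2 (Or.inl h3))
  · intro α β γ δ h1 h2 h3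
    have e : S α γ := by rw [hS] at *; omega
    have e1 : S β γ := by rw [hS] at *; omega
    have e2 : S α δ := by rw [hS] at *; omega
    simp only [h3, e, e1, e2, if_true]; exact h.qcross α β γ δ h1 h2 ((hS' _ _).2 (Or.inl h3))
  · intro i j hij
    simp [hij]

/-- Presented algebra. -/
structure IsPres {k : Type u} [Field k] (q : k) {n : ℕ} (S : Fin n → Fin n → Prop) {A : Type u}
    [Ring A] [Algebra k A] (t : Fin n → Fin n → A) : Prop where
  qs : QS q S t
  gen : Algebra.adjoin k (Set.range fun p : Fin n × Fin n => t p.1 p.2) = ⊤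
  univ : ∀ (B : Type u) [Ring B] [Algebra k B] (v : Fin n → Fin n → B), QS q S v →
    ∃ f : A →ₐ[k] B, ∀ i j, f (t i j) = v i j

/-- relations -/
inductive prel {k : Type u} [Field k] (q : k) {n : ℕ} (S : Fin n → Fin n → Prop) :
    FreeAlgebra k (Fin n × Fin n) → FreeAlgebra k (Fin n × Fin n) → Prop
  | row (α γ δ : Fin n) (h : γ < δ) (h' : S α δ) :
      prel q S (FreeAlgebra.ι k (α, γ) * FreeAlgebra.ι k (α, δ))
        (q • (FreeAlgebra.ι k (α, δ) * FreeAlgebra.ι k (α, γ)))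
  | col (α β γ : Fin n) (h : α < β) (h' : S β γ) :
      prel q S (FreeAlgebra.ι k (α, γ) * FreeAlgebra.ι k (β, γ))
        (q • (FreeAlgebra.ι k (β, γ) * FreeAlgebra.ι k (α, γ)))
  | cross (α β γ δ : Fin n) (h₁ : α < β) (h₂ : δ < γ) (h' : S β δ) :
      prel q S (FreeAlgebra.ι k (α, γ) * FreeAlgebra.ι k (β, δ))
        (FreeAlgebra.ι k (β, δ) * FreeAlgebra.ι k (α, γ))
  | qcross (α β γ δ : Fin n) (h₁ : α < β) (h₂ : γ < δ) (h' : S β δ) :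
      prel q S (FreeAlgebra.ι k (α, γ) * FreeAlgebra.ι k (β, δ) -
          FreeAlgebra.ι k (β, δ) * FreeAlgebra.ι k (α, γ))
        ((q - q⁻¹) • (FreeAlgebra.ι k (β, γ) * FreeAlgebra.ι k (α, δ)))
  | zero (i j : Fin n) (h : ¬ S i j) : prel q S (FreeAlgebra.ι k (i, j)) 0

lemma gen_quot {k : Type u} [Field k] {n : ℕ}
    (r : FreeAlgebra k (Fin n × Fin n) → FreeAlgebra k (Fin n × Fin n) → Prop) :
    Algebra.adjoin k (Set.range fun p : Fin n × Fin n =>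
      RingQuot.mkAlgHom k r (FreeAlgebra.ι k (p.1, p.2))) = ⊤ := by
  have : (Set.range fun p : Fin n × Fin n => RingQuot.mkAlgHom k r (FreeAlgebra.ι k (p.1, p.2)))
    = RingQuot.mkAlgHom k r '' Set.range (FreeAlgebra.ι k) := by
    rw [← Set.range_comp]; rfl
  rw [this, ← AlgHom.map_adjoin, FreeAlgebra.adjoin_range_ι, Algebra.map_top]
  exact (AlgHom.range_eq_top _).2 (RingQuot.mkAlgHom_surjective k r)

lemma isPres_quot {k : Type u} [Field k] (q : k) {n : ℕ} (S : Fin n → Fin n → Prop) :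
    IsPres q S (fun i j => RingQuot.mkAlgHom k (prel q S) (FreeAlgebra.ι k (i, j))) where
  qs :=
    { row := fun α γ δ h1 h2 => by
        simpa only [map_mul, map_smul] using RingQuot.mkAlgHom_rel k (prel.row (q := q) (S := S) α γ δ h1 h2)
      col := fun α β γ h1 h2 => by
        simpa only [map_mul, map_smul] using RingQuot.mkAlgHom_rel k (prel.col (q := q) (S := S) α β γ h1 h2)
      cross := fun α β γ δ h1 h2 h3 => by
        simpa only [map_mul, map_smul] using
          RingQuot.mkAlgHom_rel k (prel.cross (q := q) (S := S) α β γ δ h1 h2 h3)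
      qcross := fun α β γ δ h1 h2 h3 => by
        simpa only [map_mul, map_smul, map_sub] using
          RingQuot.mkAlgHom_rel k (prel.qcross (q := q) (S := S) α β γ δ h1 h2 h3)
      zero := fun i j h => by
        simpa only [map_zero] using RingQuot.mkAlgHom_rel k (prel.zero (q := q) (S := S) i j h) }
  gen := gen_quot _
  univ B _ _ v hv := by
    refine ⟨RingQuot.liftAlgHom k ⟨FreeAlgebra.lift k (fun p => v p.1 p.2), ?_⟩, ?_⟩
    · intro x y hxy
      induction hxy with
      | row α γ δ h h' => simpa using hv.row α γ δ h h'
      | col α β γ h h' => simpa using hv.col α β γ h h'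
      | cross α β γ δ h h1 h' => simpa using hv.cross α β γ δ h h1 h'
      | qcross α β γ δ h h1 h' => simpa using hv.qcross α β γ δ h h1 h'
      | zero i j h => simpa using hv.zero i j h
    · intro i j; simp

lemma IsPres.ind {k : Type u} [Field k] {q : k} {n : ℕ} {S : Fin n → Fin n → Prop} {A : Type u}
    [Ring A] [Algebra k A] {t : Fin n → Fin n → A} (h : IsPres q S t) {P : A → Prop}
    (hg : ∀ i j, P (t i j)) (ha : ∀ c, P (algebraMap k A c)) (hadd : ∀ a b, P a → P b → P (a + b))
    (hmul : ∀ a b, P a → P b → P (a * b)) (a : A) : P a := by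
  have : a ∈ Algebra.adjoin k (Set.range fun p : Fin n × Fin n => t p.1 p.2) := by
    rw [h.gen]; trivial
  induction this using Algebra.adjoin_induction with
  | mem x hx => obtain ⟨p, rfl⟩ := hx; exact hg _ _
  | algebraMap r => exact ha r
  | add x y _ _ h1 h2 => exact hadd _ _ h1 h2
  | mul x y _ _ h1 h2 => exact hmul _ _ h1 h2

end pres
end QMin
namespace QMin
section step

lemma step {k : Type u} [Field k] {q : k} (hq : q ≠ 0) {n : ℕ} {S S' : Fin n → Fin n → Prop}
    {A B : Type u} [Ring A] [Algebra k A] [Ring B] [Algebra k B] {t : Fin n → Fin n → A}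
    {w : Fin n → Fin n → B} (hA : IsPres q S t) (hB : IsPres q S' w) {b d : Fin n}
    (hS : ∀ i j, S i j ↔ i < b ∨ (i = b ∧ j < d)) (hS' : ∀ i j, S' i j ↔ S i j ∨ (i = b ∧ j = d))
    [NoZeroDivisors A] : NoZeroDivisors B := by
  classical
  -- the automorphism
  obtain ⟨σ, hσ⟩ := hA.univ A _
    (hA.qs.scale (fun i => if i = b then q⁻¹ else 1) (fun j => if j = d then q⁻¹ else 1))
  change ∀ i j, σ (t i j) = cc q b d i j • t i j at hσ
  obtain ⟨σ', hσ'⟩ := hA.univ A _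
    (hA.qs.scale (fun i => if i = b then q else 1) (fun j => if j = d then q else 1))
  have hinv : ∀ a, σ' (σ a) = a := by
    refine hA.ind (P := fun a => σ' (σ a) = a) ?_ ?_ ?_ ?_
    · intro i j
      rw [hσ, map_smul, hσ', smul_smul]
      have : cc q b d i j * ((if i = b then q else 1) * (if j = d then q else 1)) = 1 := by
        unfold cc; split_ifs <;> field_simp
      rw [this, one_smul]
    · intro c; simp
    · intro a b ha hb; rw [map_add, map_add, ha, hb]
    · intro a b ha hb; rw [map_mul, map_mul, ha, hb]
  have hσi : Function.Injective σ := Function.LeftInverse.injective hinv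
  -- the derivation
  obtain ⟨τ, hτ⟩ := hA.univ _ _ (QS.tri hq hA.qs hS)
  have hτa : ∀ a, τ a = tri (σ a) (τ a 0 1) a := by
    refine hA.ind (P := fun a => τ a = tri (σ a) (τ a 0 1) a) ?_ ?_ ?_ ?_
    · intro i j; rw [hτ, hσ]; rfl
    · intro c
      rw [AlgHom.commutes, AlgHom.commutes]
      ext x y; fin_cases x <;> fin_cases y <;> simp [tri, Matrix.algebraMap_matrix_apply]
    · intro a b ha hb
      rw [map_add, ha, hb, map_add]
      ext x y; fin_cases x <;> fin_cases y <;> simp [tri]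
    · intro a b ha hb
      rw [map_mul, ha, hb, map_mul, tri_mul]; rfl
  let δ : A →ₗ[k] A :=
    { toFun := fun a => τ a 0 1
      map_add' := fun a b => by rw [map_add]; rfl
      map_smul' := fun c a => by rw [map_smul]; rfl }
  have hδt : ∀ i j, δ (t i j) = dl q t b d i j := fun i j => by
    change τ (t i j) 0 1 = _; rw [hτ]; rfl
  have hδmul : ∀ a b, δ (a * b) = σ a * δ b + δ a * b := fun a b => by
    change τ (a * b) 0 1 = σ a * τ b 0 1 + τ a 0 1 * b
    rw [map_mul, hτa a, hτa b, tri_mul]; rfl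
  have hδ1 : δ 1 = 0 := by
    change τ 1 0 1 = 0
    rw [map_one]; simp
  have hδa : ∀ c, δ (algebraMap k A c) = 0 := fun c => by
    rw [Algebra.algebraMap_eq_smul_one, map_smul, hδ1, smul_zero]
  -- the map to B
  obtain ⟨f, hf⟩ := hA.univ B _ (hB.qs.restrict hS hS')
  have hbd : S' b d := (hS' _ _).2 (Or.inr ⟨rfl, rfl⟩)
  have hx : ∀ a, w b d * f a = f (σ a) * w b d + f (δ a) := by
    refine hA.ind (P := fun a => w b d * f a = f (σ a) * w b d + f (δ a)) ?_ ?_ ?_ ?_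
    · intro i j
      rw [hσ, hδt, map_smul]
      by_cases hij : S i j
      · have hij' := (hS _ _).1 hij
        have fij : f (t i j) = w i j := by rw [hf, if_pos hij]
        rw [fij]
        rcases hij' with h1 | ⟨rfl, h1⟩
        · rcases lt_trichotomy j d with h2 | rfl | h2
          · have e1 : f (t b j) = w b j := by
              rw [hf, if_pos]; rw [hS]; exact Or.inr ⟨rfl, h2⟩
            have e2 : f (t i d) = w i d := by
              rw [hf, if_pos]; rw [hS]; exact Or.inl h1
            have := hB.qs.qcross i b j d h1 h2 hbd
            simp only [cc, dl, h1, h2, h1.ne, h2.ne, and_self, if_true, if_false, mul_one, one_smul,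
              map_smul, map_neg, map_mul, e1, e2, neg_smul]
            rw [← this]; abel
          · have := hB.qs.col i b j h1 hbd
            simp [cc, dl, h1.ne, this, smul_smul, hq]
          · have := hB.qs.cross i b j d h1 h2 hbd
            simp [cc, dl, h1.ne, h2.ne', h2.not_gt, this]
        · have := hB.qs.row i j d h1 hbd
          simp [cc, dl, h1.ne, this, smul_smul, hq]
      · have : dl q t b d i j = 0 := by
          have : ¬ (i < b ∧ j < d) := fun hh => hij ((hS _ _).2 (Or.inl hh.1))
          simp [dl, this]
        simp [hA.qs.zero i j hij, this]
    · intro c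
      simp only [AlgHom.commutes]
      rw [hδa, map_zero, add_zero]
      exact (Algebra.commutes c _).symm
    · intro a b ha hb
      simp only [map_add, mul_add, add_mul, ha, hb]; abel
    · intro a b ha hb
      rw [map_mul, ← mul_assoc, ha, add_mul, mul_assoc, hb, hδmul]
      simp only [map_mul, map_add, mul_add, mul_assoc]
      abel
  have hgen : Algebra.adjoin k (Set.range f ∪ {w b d}) = ⊤ := by
    rw [eq_top_iff, ← hB.gen]
    apply Algebra.adjoin_mono
    rintro _ ⟨⟨i, j⟩, rfl⟩
    by_cases h1 : S i j
    · left; exact ⟨t i j, by rw [hf, if_pos h1]⟩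
    · by_cases h2 : i = b ∧ j = d
      · right; rw [h2.1, h2.2]; rfl
      · left; refine ⟨0, ?_⟩
        rw [map_zero]; symm; apply hB.qs.zero; rw [hS']; tauto
  -- the representation
  have hact : ∀ a, Xop σ δ * Algebra.lsmul k k (ℕ → A) a =
      Algebra.lsmul k k (ℕ → A) (σ a) * Xop σ δ + Algebra.lsmul k k (ℕ → A) (δ a) := by
    intro a
    refine LinearMap.ext fun p => ?_
    funext i
    cases i with
    | zero => simp [Module.End.mul_apply, Xop_zero, hδmul]
    | succ i => simp [Module.End.mul_apply, Xop_succ, hδmul, mul_add]; abel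
  obtain ⟨ρ, hρ⟩ := hB.univ (Module.End k (ℕ → A)) _
    ((hA.qs.map (Algebra.lsmul k k (ℕ → A))).extend hq hS hS' (Xop σ δ) (by
      intro i j _
      rw [hact, hσ, hδt, map_smul, smul_mul_assoc]
      congr 1
      simp only [dl]
      split_ifs
      · rw [map_smul, map_mul]
      · rw [map_zero]))
  have hρf : ∀ a, ρ (f a) = Algebra.lsmul k k (ℕ → A) a := by
    refine hA.ind (P := fun a => ρ (f a) = Algebra.lsmul k k (ℕ → A) a) ?_ ?_ ?_ ?_
    · intro i j
      by_cases h1 : S i j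
      · rw [hf, if_pos h1, hρ, if_neg]
        rw [hS] at h1; omega
      · rw [hA.qs.zero i j h1]; simp
    · intro c; simp only [AlgHom.commutes]
    · intro a b ha hb; simp only [map_add, ha, hb]
    · intro a b ha hb; simp only [map_mul, ha, hb]
  refine ore_domain f (w b d) σ δ hσi hδ1 hx hgen ρ (fun a p i => ?_) ?_
  · rw [hρf]; rfl
  · rw [hρ, if_pos ⟨rfl, rfl⟩]

theorem domain_pres {k : Type u} [Field k] {q : k} (hq : q ≠ 0) {n : ℕ} (N : ℕ) (hN : N ≤ n * n)
    (A : Type u) [Ring A] [Algebra k A] (t : Fin n → Fin n → A)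
    (hA : IsPres q (fun i j => (i : ℕ) * n + j < N) t) : NoZeroDivisors A := by
  induction N generalizing A with
  | zero =>
    have hz : ∀ i j, t i j = 0 := fun i j => hA.qs.zero i j (by simp)
    have hs : ∀ a : A, ∃ c, algebraMap k A c = a := by
      refine hA.ind (P := fun a => ∃ c, algebraMap k A c = a) ?_ ?_ ?_ ?_
      · intro i j; exact ⟨0, by rw [hz, map_zero]⟩
      · intro c; exact ⟨c, rfl⟩
      · rintro _ _ ⟨c, rfl⟩ ⟨c', rfl⟩; exact ⟨c + c', map_add _ _ _⟩
      · rintro _ _ ⟨c, rfl⟩ ⟨c', rfl⟩; exact ⟨c * c', map_mul _ _ _⟩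
    constructor
    intro a b hab
    obtain ⟨c, rfl⟩ := hs a
    by_cases hc : c = 0
    · left; rw [hc, map_zero]
    · right
      have : algebraMap k A c⁻¹ * (algebraMap k A c * b) = b := by
        rw [← mul_assoc, ← map_mul, inv_mul_cancel₀ hc, map_one, one_mul]
      rw [← this, hab, mul_zero]
  | succ N ih =>
    have hn : 0 < n := by
      rcases Nat.eq_zero_or_pos n with rfl | h
      · simp at hN
      · exact h
    let b : Fin n := ⟨N / n, by rw [Nat.div_lt_iff_lt_mul hn]; omega⟩
    let d : Fin n := ⟨N % n, Nat.mod_lt _ hn⟩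
    have hdiv : n * (N / n) + N % n = N := Nat.div_add_mod N n
    have hS : ∀ i j : Fin n, (i : ℕ) * n + j < N ↔ i < b ∨ (i = b ∧ j < d) := by
      intro i j
      rw [Fin.lt_def, Fin.ext_iff, Fin.lt_def]
      change _ ↔ (i : ℕ) < N / n ∨ ((i : ℕ) = N / n ∧ (j : ℕ) < N % n)
      have hj := j.2
      have hm := Nat.mod_lt N hn
      generalize N / n = Q at *
      generalize N % n = r at *
      rcases lt_trichotomy (i : ℕ) Q with h | h | h
      · have : ((i : ℕ) + 1) * n ≤ Q * n := Nat.mul_le_mul_right _ h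
        constructor
        · intro _; exact Or.inl h
        · intro _; nlinarith
      · rw [h]
        constructor
        · intro hh; right; refine ⟨rfl, ?_⟩; nlinarith
        · rintro (hh | ⟨_, hh⟩)
          · omega
          · nlinarith
      · have : (Q + 1) * n ≤ (i : ℕ) * n := Nat.mul_le_mul_right _ h
        constructor
        · intro _; nlinarith
        · intro hh; omega
    have hS' : ∀ i j : Fin n, (i : ℕ) * n + j < N + 1 ↔ (i : ℕ) * n + j < N ∨ (i = b ∧ j = d) := by
      intro i j
      rw [Nat.lt_succ_iff_lt_or_eq]
      refine or_congr Iff.rfl ?_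
      rw [Fin.ext_iff, Fin.ext_iff]
      change _ ↔ (i : ℕ) = N / n ∧ (j : ℕ) = N % n
      constructor
      · intro hh
        rw [← hh, add_comm, Nat.add_mul_div_right _ _ hn, Nat.add_mul_mod_self_right,
          Nat.div_eq_of_lt j.2, Nat.mod_eq_of_lt j.2]
        simp
      · rintro ⟨h1, h2⟩; rw [h1, h2, mul_comm]; exact hdiv
    have hQ := isPres_quot q (fun i j : Fin n => (i : ℕ) * n + j < N)
    have := ih (by omega) _ _ hQ
    exact step hq hQ hA hS hS'

end step
end QMin
namespace QMin
section matching

/-- inversions of a word -/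
def winv {m n : ℕ} (w : Fin m → Fin n) : ℕ :=
  (Finset.univ.filter fun p : Fin m × Fin m => p.1 < p.2 ∧ w p.2 < w p.1).card

lemma winv_cons {m n : ℕ} (j : Fin n) (w : Fin m → Fin n) :
    winv (Fin.cons j w : Fin (m + 1) → Fin n) =
      (Finset.univ.filter fun b : Fin m => w b < j).card + winv w := by
  unfold winv
  simp only [Finset.card_filter, Fintype.sum_prod_type, Fin.sum_univ_succ, Fin.cons_zero, Fin.cons_succ]
  simp

lemma lo_image {m n : ℕ} {w : Fin m → Fin n} (hw : Function.Injective w) (j : Fin n) :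
    lo (insert j (Finset.univ.image w)) j = (Finset.univ.filter fun b : Fin m => w b < j).card := by
  unfold lo
  rw [← Finset.card_image_of_injective _ hw]
  congr 1
  ext x
  simp only [Finset.mem_filter, Finset.mem_insert, Finset.mem_image, Finset.mem_univ, true_and]
  constructor
  · rintro ⟨rfl | ⟨a, rfl⟩, h⟩
    · exact absurd h (lt_irrefl _)
    · exact ⟨a, h, rfl⟩
  · rintro ⟨a, h, rfl⟩; exact ⟨Or.inr ⟨a, rfl⟩, h⟩

lemma cons_cond {m n : ℕ} (j : Fin n) (w : Fin m → Fin n) (S : Finset (Fin n)) :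
    (Function.Injective (Fin.cons j w : Fin (m + 1) → Fin n) ∧
      Finset.univ.image (Fin.cons j w : Fin (m + 1) → Fin n) = S) ↔
    j ∈ S ∧ Function.Injective w ∧ Finset.univ.image w = S.erase j := by
  have e : Finset.univ.image (Fin.cons j w : Fin (m + 1) → Fin n) = insert j (Finset.univ.image w) := by
    ext x; simp [Fin.exists_fin_succ, eq_comm]
  rw [e, Fin.cons_injective_iff]
  constructor
  · rintro ⟨⟨h1, h2⟩, rfl⟩
    refine ⟨Finset.mem_insert_self _ _, h2, ?_⟩
    rw [Finset.erase_insert]; simpa using h1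
  · rintro ⟨h1, h2, h3⟩
    refine ⟨⟨?_, h2⟩, ?_⟩
    · intro hh
      have : j ∈ Finset.univ.image w := by simpa using hh
      rw [h3] at this; simp at this
    · rw [h3, Finset.insert_erase h1]

open Classical in
lemma Dm_words {k : Type*} [Field k] (q : k) {R : Type*} [Ring R] [Algebra k R] {n : ℕ}
    (t : Fin n → Fin n → R) {m : ℕ} (K : Fin m → Fin n) (hK : StrictMono K) (S : Finset (Fin n)) :
    Dm q t (Finset.univ.image K) S = ∑ w : Fin m → Fin n,
      if Function.Injective w ∧ Finset.univ.image w = S then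
        ((-q) ^ winv w) • ((List.finRange m).map fun a => t (K a) (w a)).prod else 0 := by
  induction m generalizing S with
  | zero =>
    have : Finset.univ.image K = ∅ := by simp
    rw [this, Dm_empty, D0]
    simp [Function.injective_of_subsingleton, winv, eq_comm]
  | succ m ih =>
    have e : Finset.univ.image K = insert (K 0) (Finset.univ.image (fun a : Fin m => K a.succ)) := by
      ext x; simp [Fin.exists_fin_succ, eq_comm]
    rw [e, Dm_insert, Lrow]
    · rw [← (Fin.consEquiv (fun _ : Fin (m + 1) => Fin n)).sum_comp, Fintype.sum_prod_type,
        ← Finset.sum_subset (Finset.subset_univ S)]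
      · refine Finset.sum_congr rfl fun j hj => ?_
        rw [ih (fun a => K a.succ) (fun a b h => hK (Fin.succ_lt_succ_iff.2 h)), Finset.mul_sum,
          Finset.smul_sum]
        refine Finset.sum_congr rfl fun w _ => ?_
        change _ = if Function.Injective (Fin.cons j w : Fin (m + 1) → Fin n) ∧
          Finset.univ.image (Fin.cons j w : Fin (m + 1) → Fin n) = S then
          ((-q) ^ winv (Fin.cons j w : Fin (m + 1) → Fin n)) • ((List.finRange (m + 1)).map
            fun a => t (K a) ((Fin.cons j w : Fin (m + 1) → Fin n) a)).prod else 0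
        simp only [cons_cond, hj, true_and]
        split_ifs with hc
        · rw [winv_cons, ← lo_image hc.1 j, hc.2, Finset.insert_erase hj, pow_add,
            List.finRange_succ, List.map_cons, List.prod_cons, List.map_map, mul_smul_comm, smul_smul]
          rfl
        · simp
      · intro j _ hj
        refine Finset.sum_eq_zero fun w _ => if_neg fun hh => hj ?_
        exact ((cons_cond j w S).1 hh).1
    · intro x hx
      obtain ⟨a, _, rfl⟩ := Finset.mem_image.1 hx
      exact hK (Fin.succ_pos a)

lemma qMinor_eq {k : Type u} [Field k] (q : k) {n m : ℕ} (K L : Fin m → Fin n) (hK : StrictMono K)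
    (hL : StrictMono L) :
    qMinor q K L = Dm q (qGen q) (Finset.univ.image K) (Finset.univ.image L) := by
  classical
  rw [Dm_words q _ K hK, qMinor, ← Finset.sum_filter]
  refine Finset.sum_bij (fun σ _ => L ∘ σ) ?_ ?_ ?_ ?_
  · intro σ _
    simp only [Finset.mem_filter, Finset.mem_univ, true_and]
    refine ⟨hL.injective.comp σ.injective, ?_⟩
    rw [← Finset.image_image, Finset.image_univ_equiv]
  · intro σ _ τ _ h
    ext a
    have := hL.injective (congrFun h a)
    simpa using congrArg Fin.val this
  · intro w hw
    simp only [Finset.mem_filter, Finset.mem_univ, true_and] at hw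
    have : ∀ a, ∃ c, L c = w a := fun a => by
      have : w a ∈ Finset.univ.image L := by rw [← hw.2]; simp
      simpa using this
    choose g hg using this
    have gi : Function.Injective g := fun a b h => hw.1 (by rw [← hg, ← hg, h])
    exact ⟨Equiv.ofBijective g (Finite.injective_iff_bijective.1 gi), Finset.mem_univ _, funext hg⟩
  · intro σ _
    have : winv (L ∘ σ) = inversions σ := by
      unfold winv inversions
      simp only [Function.comp, hL.lt_iff_lt]
    rw [this]; rfl

lemma qma_pres {k : Type u} [Field k] (q : k) (n : ℕ) :
    IsPres q (fun i j : Fin n => (i : ℕ) * n + j < n * n) (qGen (k := k) q (n := n)) where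
  qs :=
    { row := fun α γ δ h1 _ => by
        simpa only [qGen, map_mul, map_smul] using RingQuot.mkAlgHom_rel k (qMatRel.row (q := q) α γ δ h1)
      col := fun α β γ h1 _ => by
        simpa only [qGen, map_mul, map_smul] using RingQuot.mkAlgHom_rel k (qMatRel.col (q := q) α β γ h1)
      cross := fun α β γ δ h1 h2 _ => by
        simpa only [qGen, map_mul, map_smul] using
          RingQuot.mkAlgHom_rel k (qMatRel.cross (q := q) α β γ δ h1 h2)
      qcross := fun α β γ δ h1 h2 _ => by
        simpa only [qGen, map_mul, map_smul, map_sub] using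
          RingQuot.mkAlgHom_rel k (qMatRel.qcross (q := q) α β γ δ h1 h2)
      zero := fun i j h => by
        exfalso; apply h
        have : ((i : ℕ) + 1) * n ≤ n * n := Nat.mul_le_mul_right _ i.2
        have := j.2
        nlinarith }
  gen := gen_quot _
  univ B _ _ v hv := by
    have hS : ∀ i j : Fin n, (i : ℕ) * n + j < n * n := by
      intro i j
      have : ((i : ℕ) + 1) * n ≤ n * n := Nat.mul_le_mul_right _ i.2
      have := j.2
      nlinarith
    refine ⟨RingQuot.liftAlgHom k ⟨FreeAlgebra.lift k (fun p => v p.1 p.2), ?_⟩, ?_⟩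
    · intro x y hxy
      induction hxy with
      | row α γ δ h => simpa [freeGen] using hv.row α γ δ h (hS _ _)
      | col α β γ h => simpa [freeGen] using hv.col α β γ h (hS _ _)
      | cross α β γ δ h h1 => simpa [freeGen] using hv.cross α β γ δ h h1 (hS _ _)
      | qcross α β γ δ h h1 => simpa [freeGen] using hv.qcross α β γ δ h h1 (hS _ _)
    · intro i j; simp [qGen, freeGen]

lemma lex_all {n : ℕ} (i j : Fin n) : (i : ℕ) * n + j < n * n := by
  have : ((i : ℕ) + 1) * n ≤ n * n := Nat.mul_le_mul_right _ i.2
  have := j.2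
  nlinarith

lemma qma_QM {k : Type u} [Field k] (q : k) (n : ℕ) : QM q (qGen (k := k) q (n := n)) where
  row α γ δ h := (qma_pres q n).qs.row α γ δ h (lex_all _ _)
  col α β γ h := (qma_pres q n).qs.col α β γ h (lex_all _ _)
  cross α β γ δ h h' := (qma_pres q n).qs.cross α β γ δ h h' (lex_all _ _)
  qcross α β γ δ h h' := (qma_pres q n).qs.qcross α β γ δ h h' (lex_all _ _)

lemma qma_domain {k : Type u} [Field k] {q : k} (hq : q ≠ 0) (n : ℕ) :
    NoZeroDivisors (QuantumMatrixAlgebra k q n) :=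
  domain_pres hq (n * n) le_rfl _ _ (qma_pres q n)

lemma qMinor_char {k : Type u} [Field k] (q : k) {n m : ℕ} (K L : Fin m → Fin n) (hK : StrictMono K)
    (hL : StrictMono L) : ∃ f : QuantumMatrixAlgebra k q n →ₐ[k] k, f (qMinor q K L) = 1 := by
  classical
  let v : Fin n → Fin n → k := fun i j => if ∃ a, K a = i ∧ L a = j then 1 else 0
  have hrow : ∀ α γ δ, γ ≠ δ → v α γ * v α δ = 0 := by
    intro α γ δ h
    by_contra hne
    have h1 := left_ne_zero_of_mul hne
    have h2 := right_ne_zero_of_mul hne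
    simp only [v, ne_eq, ite_eq_right_iff, one_ne_zero, imp_false, not_not] at h1 h2
    obtain ⟨a, ha, ha'⟩ := h1
    obtain ⟨b, hb, hb'⟩ := h2
    have : a = b := hK.injective (ha.trans hb.symm)
    subst this; exact h (ha'.symm.trans hb')
  have hcol : ∀ α β γ, α ≠ β → v α γ * v β γ = 0 := by
    intro α β γ h
    by_contra hne
    have h1 := left_ne_zero_of_mul hne
    have h2 := right_ne_zero_of_mul hne
    simp only [v, ne_eq, ite_eq_right_iff, one_ne_zero, imp_false, not_not] at h1 h2
    obtain ⟨a, ha, ha'⟩ := h1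
    obtain ⟨b, hb, hb'⟩ := h2
    have : a = b := hL.injective (ha'.trans hb'.symm)
    subst this; exact h (ha.symm.trans hb)
  have hanti : ∀ α β γ δ, α < β → γ < δ → v β γ * v α δ = 0 := by
    intro α β γ δ h h'
    by_contra hne
    have h1 := left_ne_zero_of_mul hne
    have h2 := right_ne_zero_of_mul hne
    simp only [v, ne_eq, ite_eq_right_iff, one_ne_zero, imp_false, not_not] at h1 h2
    obtain ⟨a, rfl, rfl⟩ := h1
    obtain ⟨b, rfl, rfl⟩ := h2
    rw [hK.lt_iff_lt] at h
    rw [hL.lt_iff_lt] at h'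
    exact lt_asymm h h'
  have hQS : QS q (fun i j : Fin n => (i : ℕ) * n + j < n * n) v :=
    { row := fun α γ δ h1 _ => by rw [hrow _ _ _ h1.ne, hrow _ _ _ h1.ne', smul_zero]
      col := fun α β γ h1 _ => by rw [hcol _ _ _ h1.ne, hcol _ _ _ h1.ne', smul_zero]
      cross := fun α β γ δ _ _ _ => mul_comm _ _
      qcross := fun α β γ δ h1 h2 _ => by
        rw [hanti _ _ _ _ h1 h2, smul_zero, mul_comm, sub_self]
      zero := fun i j h => absurd (lex_all i j) h }
  obtain ⟨f, hf⟩ := (qma_pres q n).univ k v hQS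
  refine ⟨f, ?_⟩
  rw [qMinor, map_sum, Finset.sum_eq_single 1]
  · rw [map_smul, map_list_prod, List.map_map]
    have h1 : ∀ a, (f ∘ fun a => qGen q (K a) (L ((1 : Equiv.Perm (Fin m)) a))) a = 1 := by
      intro a
      simp only [Function.comp, hf, v, Equiv.Perm.one_apply]
      exact if_pos ⟨a, rfl, rfl⟩
    have h2 : inversions (1 : Equiv.Perm (Fin m)) = 0 := by
      unfold inversions
      rw [Finset.card_eq_zero, Finset.filter_eq_empty_iff]
      rintro ⟨a, b⟩ _ ⟨h, h'⟩
      exact lt_asymm h h'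
    rw [h2, pow_zero, one_smul, List.prod_eq_one]
    intro x hx
    obtain ⟨a, _, rfl⟩ := List.mem_map.1 hx
    exact h1 a
  · intro σ _ hσ
    rw [map_smul, map_list_prod, List.map_map]
    have : ∃ a, σ a ≠ a := by
      by_contra hh; push Not at hh
      exact hσ (Equiv.ext hh)
    obtain ⟨a, ha⟩ := this
    rw [List.prod_eq_zero, smul_zero]
    rw [List.mem_map]
    refine ⟨a, List.mem_finRange a, ?_⟩
    simp only [Function.comp, hf, v]
    refine if_neg ?_
    rintro ⟨c, hc, hc'⟩
    exact ha (by rw [← hL.injective hc', hK.injective hc])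
  · intro h; exact absurd (Finset.mem_univ _) h

end matching
end QMin
namespace QMin
section final

lemma minor_props {k : Type u} [Field k] {q : k} (hq : q ≠ 0) {n : ℕ}
    {y : QuantumMatrixAlgebra k q n} (hy : y ∈ quantumMinors k q n) :
    y ≠ 0 ∧ ∀ r, LO y r ∧ RO y r := by
  obtain ⟨m, K, L, hK, hL, rfl⟩ := hy
  have hne : qMinor q K L ≠ 0 := by
    obtain ⟨f, hf⟩ := qMinor_char q K L hK hL
    intro h0; rw [h0, map_zero] at hf; exact zero_ne_one hf
  refine ⟨hne, ?_⟩
  have := qma_domain hq n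
  have hc : (Finset.univ.image K).card = (Finset.univ.image L).card := by
    rw [Finset.card_image_of_injective _ hK.injective, Finset.card_image_of_injective _ hL.injective]
  rw [qMinor_eq q K L hK hL] at hne ⊢
  refine (qma_pres q n).ind (P := fun r => LO _ r ∧ RO _ r) ?_ ?_ ?_ ?_
  · intro i j
    exact ⟨LO_gen hq (qma_QM q n) hc hne i j, RO_gen hq (qma_QM q n) hc hne i j⟩
  · intro c
    exact ⟨LO_a (Algebra.commutes c _).symm, RO_a (Algebra.commutes c _).symm⟩
  · intro a b ha hb; exact ⟨LO_add ha.1 hb.1, RO_add ha.2 hb.2⟩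
  · intro a b ha hb; exact ⟨LO_mul ha.1 hb.1, RO_mul ha.2 hb.2⟩

end final
end QMin

/-- **Theorem 8.** Every set of quantum minors multiplicatively generates a two-sided
Ore set `S` in `M_q(n,k)`: `S` satisfies both the left and the right Ore condition, and
the Ore localization map `M_q(n,k) → S⁻¹M_q(n,k)` is injective. -/
theorem quantum_minors_generate_two_sided_ore_set
    {k : Type u} [Field k] {q : k} (hq : q ≠ 0) {n : ℕ}
    (Qset : Set (QuantumMatrixAlgebra k q n)) (hQ : Qset ⊆ quantumMinors k q n) :
    (∀ s ∈ (Submonoid.closure Qset : Set (QuantumMatrixAlgebra k q n)),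
      ∀ r : QuantumMatrixAlgebra k q n,
        ∃ s' ∈ (Submonoid.closure Qset : Set (QuantumMatrixAlgebra k q n)),
          ∃ r' : QuantumMatrixAlgebra k q n, r' * s = s' * r) ∧
    (∀ s ∈ (Submonoid.closure Qset : Set (QuantumMatrixAlgebra k q n)),
      ∀ r : QuantumMatrixAlgebra k q n,
        ∃ s'' ∈ (Submonoid.closure Qset : Set (QuantumMatrixAlgebra k q n)),
          ∃ r'' : QuantumMatrixAlgebra k q n, s * r'' = r * s'') ∧
    (∀ (Q' : Type u) [Ring Q'] (i : QuantumMatrixAlgebra k q n →+* Q'),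
      IsLeftOreRingLocalization
        (Submonoid.closure Qset : Set (QuantumMatrixAlgebra k q n)) i →
      Function.Injective i) := by
  have hdom := QMin.qma_domain hq n
  refine ⟨?_, ?_, ?_⟩
  · intro s hs
    induction hs using Submonoid.closure_induction with
    | mem y hy =>
      intro r
      obtain ⟨N, r', h⟩ := ((QMin.minor_props hq (hQ hy)).2 r).1 1
      exact ⟨y ^ N, pow_mem (Submonoid.subset_closure hy) N, r', by rw [h, pow_one]⟩
    | one => intro r; exact ⟨1, one_mem _, r, by rw [mul_one, one_mul]⟩
    | mul x y _ _ hx hy =>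
      intro r
      obtain ⟨s1, hs1, r1, h1⟩ := hy r
      obtain ⟨s2, hs2, r2, h2⟩ := hx r1
      refine ⟨s2 * s1, mul_mem hs2 hs1, r2, ?_⟩
      rw [← mul_assoc, h2, mul_assoc, h1, mul_assoc]
  · intro s hs
    induction hs using Submonoid.closure_induction with
    | mem y hy =>
      intro r
      obtain ⟨N, r', h⟩ := ((QMin.minor_props hq (hQ hy)).2 r).2 1
      exact ⟨y ^ N, pow_mem (Submonoid.subset_closure hy) N, r', by rw [h, pow_one]⟩
    | one => intro r; exact ⟨1, one_mem _, r, by rw [mul_one, one_mul]⟩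
    | mul x y _ _ hx hy =>
      intro r
      obtain ⟨s1, hs1, r1, h1⟩ := hx r
      obtain ⟨s2, hs2, r2, h2⟩ := hy r1
      refine ⟨s1 * s2, mul_mem hs1 hs2, r2, ?_⟩
      rw [mul_assoc, h2, ← mul_assoc, h1, mul_assoc]
  · intro Q' _ i hi
    have hne : ∀ s ∈ (Submonoid.closure Qset : Set (QuantumMatrixAlgebra k q n)), s ≠ 0 := by
      intro s hs
      induction hs using Submonoid.closure_induction with
      | mem y hy => exact (QMin.minor_props hq (hQ hy)).1
      | one =>
        intro h1
        have h2 : qMinor q (Fin.elim0 : Fin 0 → Fin n) Fin.elim0 ≠ 0 :=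
          (QMin.minor_props hq ⟨0, _, _, fun a => a.elim0, fun a => a.elim0, rfl⟩).1
        apply h2
        rw [← one_mul (qMinor _ _ _), h1, zero_mul]
      | mul x y _ _ hx hy => exact mul_ne_zero hx hy
    rw [injective_iff_map_eq_zero]
    intro r hr
    obtain ⟨s, hs, h0⟩ := (hi.ker r).1 hr
    exact (mul_eq_zero.1 h0).resolve_left (hne s hs)
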